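/- arXiv:1312.0670 — 2 statements merged into one kernel-verified Lean document; each statement's English description precedes it below -/
import Mathlib

section
/- There is a set B ⊆ ℕ × ℕ such that the set {n ∈ ℕ : the section B_n is arithmetic} is not definable in the structure ⟨ℕ, +, ·, 0, 1, <, B⟩ (i.e., not arithmetic in B). -/
open FirstOrder FirstOrder.Language FirstOrder.Language.Structure

/-- The function symbols of the language of arithmetic `{0, 1, +, ·}`. -/
inductive ArithFunc : ℕ → Type
  | zero : ArithFunc 0
  | one : ArithFunc 0
  | add : ArithFunc 2
  | mul : ArithFunc 2
  deriving DecidableEq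

/-- The relation symbols of the language of arithmetic: `<`. -/
inductive ArithRel : ℕ → Type
  | lt : ArithRel 2
  deriving DecidableEq

/-- The first-order language of arithmetic `⟨+, ·, 0, 1, <⟩`. -/
def Larith : FirstOrder.Language := ⟨ArithFunc, ArithRel⟩

namespace Larith

variable {N : Type*} [Larith.Structure N]

/-- The interpretation of `+` in an `Larith`-structure. -/
def addF (x y : N) : N := funMap (L := Larith) ArithFunc.add ![x, y]
/-- The interpretation of `·` in an `Larith`-structure. -/
def mulF (x y : N) : N := funMap (L := Larith) ArithFunc.mul ![x, y]
/-- The interpretation of `0` in an `Larith`-structure. -/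
def zeroF : N := funMap (L := Larith) ArithFunc.zero ![]
/-- The interpretation of `1` in an `Larith`-structure. -/
def oneF : N := funMap (L := Larith) ArithFunc.one ![]
/-- The interpretation of `<` in an `Larith`-structure. -/
def ltF (x y : N) : Prop := RelMap (L := Larith) ArithRel.lt ![x, y]

/-- The value of the standard numeral `n̄ = 1 + 1 + ⋯ + 1` (`n` times) in `N`. -/
def natE : ℕ → N
  | 0 => zeroF
  | n + 1 => addF (natE n) oneF

/-- `N` is a model of Peano arithmetic: the `PA⁻` axioms of a discretely ordered commutative
semiring, together with the full first-order induction scheme, stated semantically for every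
formula of the language of arithmetic with parameters. -/
def IsPAModel (N : Type*) [Larith.Structure N] : Prop :=
  (∀ x y z : N, addF (addF x y) z = addF x (addF y z)) ∧
  (∀ x y : N, addF x y = addF y x) ∧
  (∀ x : N, addF x zeroF = x) ∧
  (∀ x y z : N, mulF (mulF x y) z = mulF x (mulF y z)) ∧
  (∀ x y : N, mulF x y = mulF y x) ∧
  (∀ x : N, mulF x oneF = x) ∧
  (∀ x : N, mulF x zeroF = zeroF) ∧
  (∀ x y z : N, mulF x (addF y z) = addF (mulF x y) (mulF x z)) ∧
  (∀ x : N, ¬ ltF x x) ∧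
  (∀ x y z : N, ltF x y → ltF y z → ltF x z) ∧
  (∀ x y : N, ltF x y ∨ x = y ∨ ltF y x) ∧
  (∀ x y z : N, ltF x y → ltF (addF x z) (addF y z)) ∧
  (∀ x y z : N, ltF x y → ltF zeroF z → ltF (mulF x z) (mulF y z)) ∧
  (∀ x y : N, ltF x y ↔ ∃ z : N, ltF zeroF z ∧ addF x z = y) ∧
  (ltF (zeroF : N) oneF) ∧
  (∀ x : N, ltF zeroF x → ltF oneF x ∨ oneF = x) ∧
  (∀ x : N, x = zeroF ∨ ltF zeroF x) ∧
  (∀ (k : ℕ) (φ : Larith.BoundedFormula (Fin k) 1) (v : Fin k → N),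
    φ.Realize v ![zeroF] → (∀ x : N, φ.Realize v ![x] → φ.Realize v ![addF x oneF]) →
    ∀ x : N, φ.Realize v ![x])

/-- `N` is a nonstandard model: some element is not the value of any standard numeral. -/
def IsNonstandard (N : Type*) [Larith.Structure N] : Prop :=
  ∃ x : N, ∀ n : ℕ, natE n ≠ x

end Larith

/-- The standard interpretation of the language of arithmetic in `ℕ`. -/
instance : Larith.Structure ℕ where
  funMap := fun {_} f v =>
    match f with
    | .zero => 0
    | .one => 1
    | .add => v 0 + v 1
    | .mul => v 0 * v 1
  RelMap := fun {_} r v =>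
    match r with
    | .lt => v 0 < v 1

/-- The language with a single binary relation symbol `B`. -/
def Lb : FirstOrder.Language := ⟨fun _ => Empty, fun k => PLift (k = 2)⟩

/-- The expansion `⟨ℕ, +, ·, 0, 1, <, B⟩` of the standard model of arithmetic by the binary
predicate `B`. -/
def bStructure (B : Set (ℕ × ℕ)) : (Larith.sum Lb).Structure ℕ :=
  @Language.sumStructure Larith Lb ℕ _
    ⟨fun {_} f _ => f.elim,
     fun {_} r v => (v (Fin.cast r.down.symm 0), v (Fin.cast r.down.symm 1)) ∈ B⟩

/-- `A ⊆ ℕ` is arithmetic: definable in the standard model `⟨ℕ, +, ·, 0, 1, <⟩` of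
arithmetic. -/
def IsArithmetic (A : Set ℕ) : Prop :=
  ∃ φ : Larith.Formula (Fin 1), ∀ n : ℕ, n ∈ A ↔ φ.Realize ![n]

namespace ArithForcing

/-- A predicate on valuations that is defined by a formula in the standard model of arithmetic. -/
def Ar {α : Type} (P : (α → ℕ) → Prop) : Prop :=
  ∃ φ : Larith.Formula α, ∀ v, φ.Realize v ↔ P v

/-- A function on valuations whose graph is arithmetic. -/
def ArFun {α : Type} (f : (α → ℕ) → ℕ) : Prop :=
  Ar fun w : Option α → ℕ => w none = f fun i => w (some i)

/-- An arithmetic set of natural numbers. -/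
def Ar₁ (X : ℕ → Prop) : Prop := Ar fun v : Fin 1 → ℕ => X (v 0)

/-- An arithmetic binary relation. -/
def Ar₂ (R : ℕ → ℕ → Prop) : Prop := Ar fun v : Fin 2 → ℕ => R (v 0) (v 1)

/-- An arithmetic unary function. -/
def ArFun₁ (f : ℕ → ℕ) : Prop := ArFun fun v : Fin 1 → ℕ => f (v 0)

section Closure

variable {α β : Type} {P Q : (α → ℕ) → Prop} {f g : (α → ℕ) → ℕ}

theorem Ar.congr (hP : Ar P) (h : ∀ v, Q v ↔ P v) : Ar Q :=
  hP.imp fun _ hφ v => (hφ v).trans (h v).symm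

theorem Ar.not (hP : Ar P) : Ar fun v => ¬ P v :=
  let ⟨φ, hφ⟩ := hP
  ⟨φ.not, fun v => by simp [Formula.realize_not, hφ]⟩

theorem Ar.and (hP : Ar P) (hQ : Ar Q) : Ar fun v => P v ∧ Q v :=
  let ⟨φ, hφ⟩ := hP
  let ⟨ψ, hψ⟩ := hQ
  ⟨φ ⊓ ψ, fun v => by simp [Formula.realize_inf, hφ, hψ]⟩

theorem Ar.or (hP : Ar P) (hQ : Ar Q) : Ar fun v => P v ∨ Q v :=
  (hP.not.and hQ.not).not.congr fun _ => by tauto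

theorem Ar.imp (hP : Ar P) (hQ : Ar Q) : Ar fun v => P v → Q v :=
  (hP.not.or hQ).congr fun _ => by tauto

theorem Ar.iff (hP : Ar P) (hQ : Ar Q) : Ar fun v => P v ↔ Q v :=
  ((hP.imp hQ).and (hQ.imp hP)).congr fun _ => by tauto

theorem Ar.reindex (hP : Ar P) (r : α → β) : Ar fun w : β → ℕ => P fun i => w (r i) :=
  let ⟨φ, hφ⟩ := hP
  ⟨φ.relabel r, fun _ => Formula.realize_relabel.trans (hφ _)⟩

theorem Ar.ex {R : ℕ → (α → ℕ) → Prop}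
    (hR : Ar fun w : Option α → ℕ => R (w none) fun i => w (some i)) :
    Ar fun v => ∃ x, R x v := by
  obtain ⟨φ, hφ⟩ := hR
  refine ⟨(BoundedFormula.relabel (n := 1) (k := 0)
    (fun o : Option α => o.elim (Sum.inr 0) Sum.inl) φ).ex, fun v => ?_⟩
  refine BoundedFormula.realize_ex.trans (exists_congr fun x => ?_)
  refine BoundedFormula.realize_relabel.trans ?_
  refine Iff.trans ?_ (hφ fun o => o.elim x v)
  refine iff_of_eq (congr_arg₂ _ ?_ (Subsingleton.elim _ _))
  funext o
  cases o <;> simp [Fin.snoc]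

theorem Ar.all {R : ℕ → (α → ℕ) → Prop}
    (hR : Ar fun w : Option α → ℕ => R (w none) fun i => w (some i)) :
    Ar fun v => ∀ x, R x v :=
  (Ar.ex (R := fun x v => ¬ R x v) hR.not).not.congr fun _ => by simp

theorem ArFun.ar_ex {R : ℕ → (α → ℕ) → Prop} (hf : ArFun f)
    (hR : Ar fun w : Option α → ℕ => R (w none) fun i => w (some i)) :
    Ar fun v => R (f v) v :=
  (Ar.ex (R := fun x v => x = f v ∧ R x v) (hf.and hR)).congr fun _ => by simp

theorem ArFun.reindex (hf : ArFun f) (r : α → β) : ArFun fun w : β → ℕ => f fun i => w (r i) :=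
  Ar.reindex hf (Option.map r)

theorem Ar₁.comp {X : ℕ → Prop} (hX : Ar₁ X) (hf : ArFun f) : Ar fun v => X (f v) :=
  hf.ar_ex (R := fun x _ => X x) (Ar.reindex hX fun _ => none)

theorem Ar₂.comp {R : ℕ → ℕ → Prop} (hR : Ar₂ R) (hf : ArFun f) (hg : ArFun g) :
    Ar fun v => R (f v) (g v) :=
  hf.ar_ex (R := fun x v => R x (g v)) <|
    (hg.reindex some).ar_ex (R := fun y w => R (w none) y) <|
      Ar.reindex hR ![some none, none]

theorem ar₂_eq : Ar₂ (· = ·) :=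
  ⟨(Term.var 0).equal (Term.var 1), fun v => by simp [Formula.realize_equal]⟩

theorem ar₂_lt : Ar₂ (· < ·) :=
  ⟨Relations.formula₂ (L := Larith) ArithRel.lt (Term.var 0) (Term.var 1),
    fun _ => Formula.realize_rel₂⟩

theorem ArFun.eq (hf : ArFun f) (hg : ArFun g) : Ar fun v => f v = g v := ar₂_eq.comp hf hg

theorem ArFun.lt (hf : ArFun f) (hg : ArFun g) : Ar fun v => f v < g v := ar₂_lt.comp hf hg

theorem ArFun.le (hf : ArFun f) (hg : ArFun g) : Ar fun v => f v ≤ g v :=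
  (hg.lt hf).not.congr fun _ => by simp

theorem arFun_var (i : α) : ArFun fun v => v i :=
  Ar.reindex ar₂_eq ![none, some i]

theorem ArFun₁.comp {t : ℕ → ℕ} (ht : ArFun₁ t) (hf : ArFun f) : ArFun fun v => t (f v) :=
  (hf.reindex some).ar_ex (R := fun x w => w none = t x) <|
    Ar.reindex ht fun o => o.elim (some none) fun _ => none

theorem arFun_zero : ArFun fun _ : α → ℕ => 0 :=
  ⟨(Term.var none).equal (Constants.term (L := Larith) ArithFunc.zero), fun _ =>
    Formula.realize_equal.trans Iff.rfl⟩

theorem arFun_one : ArFun fun _ : α → ℕ => 1 :=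
  ⟨(Term.var none).equal (Constants.term (L := Larith) ArithFunc.one), fun _ =>
    Formula.realize_equal.trans Iff.rfl⟩

theorem ArFun.add (hf : ArFun f) (hg : ArFun g) : ArFun fun v => f v + g v := by
  refine (hf.reindex some).ar_ex (R := fun x w => w none = x + g fun i => w (some i)) ?_
  refine ((hg.reindex some).reindex some).ar_ex (R := fun y w => w (some none) = w none + y) ?_
  exact ⟨(Term.var (some (some none))).equal
    (Functions.apply₂ (L := Larith) ArithFunc.add (Term.var (some none)) (Term.var none)),
    fun _ => Formula.realize_equal.trans Iff.rfl⟩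

theorem ArFun.mul (hf : ArFun f) (hg : ArFun g) : ArFun fun v => f v * g v := by
  refine (hf.reindex some).ar_ex (R := fun x w => w none = x * g fun i => w (some i)) ?_
  refine ((hg.reindex some).reindex some).ar_ex (R := fun y w => w (some none) = w none * y) ?_
  exact ⟨(Term.var (some (some none))).equal
    (Functions.apply₂ (L := Larith) ArithFunc.mul (Term.var (some none)) (Term.var none)),
    fun _ => Formula.realize_equal.trans Iff.rfl⟩

theorem arFun_const (n : ℕ) : ArFun fun _ : α → ℕ => n := by
  induction n with
  | zero => exact arFun_zero
  | succ n ih => exact ih.add arFun_one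

theorem ArFun.pair (hf : ArFun f) (hg : ArFun g) : ArFun fun v => Nat.pair (f v) (g v) := by
  have hf' := hf.reindex (some : α → Option α)
  have hg' := hg.reindex (some : α → Option α)
  refine Ar.congr (((hf'.lt hg').and ((arFun_var none).eq ((hg'.mul hg').add hf'))).or
    ((hg'.le hf').and ((arFun_var none).eq (((hf'.mul hf').add hf').add hg')))) fun w => ?_
  change _ = Nat.pair (f _) (g _) ↔ _
  unfold Nat.pair
  split_ifs with h
  · simp [h]
  · simp [h, not_lt.mp h]

theorem ArFun.unpair_fst (hf : ArFun f) : ArFun fun v => (Nat.unpair (f v)).1 := by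
  refine (Ar.ex (R := fun b w => Nat.pair (w none) b = f fun i => w (some i)) <|
    ((arFun_var _).pair (arFun_var _)).eq ((hf.reindex some).reindex some)).congr fun w => ?_
  constructor
  · intro h
    exact ⟨_, by rw [h, Nat.pair_unpair]⟩
  · rintro ⟨b, hb⟩
    simp [← hb]

theorem ArFun.unpair_snd (hf : ArFun f) : ArFun fun v => (Nat.unpair (f v)).2 := by
  refine (Ar.ex (R := fun a w => Nat.pair a (w none) = f fun i => w (some i)) <|
    ((arFun_var _).pair (arFun_var _)).eq ((hf.reindex some).reindex some)).congr fun w => ?_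
  constructor
  · intro h
    exact ⟨_, by rw [h, Nat.pair_unpair]⟩
  · rintro ⟨b, hb⟩
    simp [← hb]

theorem ArFun.mod_succ (hf : ArFun f) (hg : ArFun g) : ArFun fun v => f v % (g v + 1) := by
  have hg' := (hg.reindex (some : α → Option α)).add arFun_one
  refine (((arFun_var none).lt hg').and
    (Ar.ex (R := fun q w => (f fun i => w (some i)) = ((g fun i => w (some i)) + 1) * q + w none) <|
      ((hf.reindex some).reindex some).eq
        (((hg'.reindex some).mul (arFun_var none)).add (arFun_var _)))).congr fun w => ?_
  constructor
  · intro h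
    rw [h]
    exact ⟨Nat.mod_lt _ (Nat.succ_pos _), _, (Nat.div_add_mod _ _).symm⟩
  · rintro ⟨hlt, q, hq⟩
    change _ = f _ % (g _ + 1)
    rw [hq, Nat.mul_add_mod, Nat.mod_eq_of_lt hlt]

theorem ArFun.beta (hf : ArFun f) (hg : ArFun g) : ArFun fun v => Nat.beta (f v) (g v) :=
  ArFun.mod_succ hf.unpair_fst ((hg.add arFun_one).mul hf.unpair_snd)

end Closure

theorem isArithmetic_iff {X : Set ℕ} : IsArithmetic X ↔ Ar₁ (· ∈ X) := by
  constructor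
  · rintro ⟨φ, hφ⟩
    refine ⟨φ, fun v => ?_⟩
    have hv : v = ![v 0] := funext fun i => by rw [Subsingleton.elim i 0]; rfl
    change _ ↔ v 0 ∈ X
    rw [hφ, ← hv]
  · rintro ⟨φ, hφ⟩
    exact ⟨φ, fun n => (hφ ![n]).symm⟩

/-- The length of the finite binary string coded by `c`. -/
def len (c : ℕ) : ℕ := (Nat.unpair c).1

/-- The `z`-th bit of the finite binary string coded by `c` is `1`. -/
def Bit (c z : ℕ) : Prop := Nat.beta (Nat.unpair c).2 z = 1

/-- The string coded by `q` extends the string coded by `c`. -/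
def Ext (q c : ℕ) : Prop := len c ≤ len q ∧ ∀ z, z < len c → (Bit q z ↔ Bit c z)

/-- The string coded by `c` is an initial segment of `G`. -/
def Approx (G : Set ℕ) (c : ℕ) : Prop := ∀ z, z < len c → (Bit c z ↔ z ∈ G)

/-- The string coded by `c` agrees with `A` on the positions in `O`. -/
def Adm (O A : ℕ → Prop) (c : ℕ) : Prop := ∀ z, z < len c → O z → (Bit c z ↔ A z)

/-- The set `G` agrees with `A` on `O`. -/
def Compat (O A : ℕ → Prop) (G : Set ℕ) : Prop := ∀ z, O z → (z ∈ G ↔ A z)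

theorem exists_beta (n : ℕ) (f : ℕ → ℕ) : ∃ s, ∀ i < n, Nat.beta s i = f i := by
  refine ⟨Nat.unbeta ((List.range n).map f), fun i hi => ?_⟩
  have := Nat.beta_unbeta_coe ((List.range n).map f) ⟨i, by simpa using hi⟩
  simpa using this

theorem exists_string (l : ℕ) (X : ℕ → Prop) : ∃ c, len c = l ∧ ∀ z < l, (Bit c z ↔ X z) := by
  classical
  obtain ⟨s, hs⟩ := exists_beta l fun z => if X z then 1 else 0
  refine ⟨Nat.pair l s, by simp [len], fun z hz => ?_⟩
  simp [Bit, hs z hz]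

section Definability

variable {α : Type} {f g : (α → ℕ) → ℕ}

theorem ArFun.len (hf : ArFun f) : ArFun fun v => len (f v) := hf.unpair_fst

theorem ArFun.bit (hf : ArFun f) (hg : ArFun g) : Ar fun v => Bit (f v) (g v) :=
  (hf.unpair_snd.beta hg).eq arFun_one

theorem ar₂_ext : Ar₂ Ext :=
  ((arFun_var _).len.le (arFun_var _).len).and <| Ar.all <|
    ((arFun_var _).lt (arFun_var _).len).imp <|
      ((arFun_var _).bit (arFun_var _)).iff ((arFun_var _).bit (arFun_var _))

theorem Ar₁.adm {O A : ℕ → Prop} (hO : Ar₁ O) (hA : Ar₁ A) : Ar₁ (Adm O A) :=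
  Ar.all <| ((arFun_var _).lt (arFun_var _).len).imp <| (hO.comp (arFun_var _)).imp <|
    ((arFun_var _).bit (arFun_var _)).iff (hA.comp (arFun_var _))

end Definability

theorem Ext.refl (c : ℕ) : Ext c c := ⟨le_rfl, fun _ _ => Iff.rfl⟩

theorem Ext.trans {p q r : ℕ} (h : Ext p q) (h' : Ext q r) : Ext p r :=
  ⟨h'.1.trans h.1, fun z hz => (h.2 z (hz.trans_le h'.1)).trans (h'.2 z hz)⟩

theorem Approx.of_ext {G : Set ℕ} {q c : ℕ} (h : Approx G q) (hqc : Ext q c) : Approx G c :=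
  fun z hz => (hqc.2 z hz).symm.trans (h z (hz.trans_le hqc.1))

theorem Approx.ext {G : Set ℕ} {q c : ℕ} (hq : Approx G q) (hc : Approx G c)
    (h : len c ≤ len q) : Ext q c :=
  ⟨h, fun z hz => (hq z (hz.trans_le h)).trans (hc z hz).symm⟩

theorem Approx.directed {G : Set ℕ} {p c : ℕ} (hp : Approx G p) (hc : Approx G c) :
    ∃ q, Approx G q ∧ Ext q p ∧ Ext q c := by
  rcases le_total (len p) (len c) with h | h
  · exact ⟨c, hc, hc.ext hp h, Ext.refl c⟩
  · exact ⟨p, hp, Ext.refl p, hp.ext hc h⟩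

theorem exists_approx (G : Set ℕ) (l : ℕ) : ∃ c, Approx G c ∧ len c = l := by
  obtain ⟨c, hl, hc⟩ := exists_string l (· ∈ G)
  exact ⟨c, fun z hz => hc z (hl ▸ hz), hl⟩

theorem Approx.adm {O A : ℕ → Prop} {G : Set ℕ} {c : ℕ} (hc : Approx G c)
    (hG : Compat O A G) : Adm O A c :=
  fun z hz hO => (hc z hz).trans (hG z hO)

open Classical in
/-- An admissible string can be extended by arbitrary bits at the positions outside `O`. -/
theorem Adm.exists_ext {O A : ℕ → Prop} {c l : ℕ} (hc : Adm O A c) (hl : len c ≤ l)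
    (X : ℕ → Prop) : ∃ q, Adm O A q ∧ Ext q c ∧ len q = l ∧
      ∀ z, len c ≤ z → z < l → ¬ O z → (Bit q z ↔ X z) := by
  obtain ⟨q, hq, hb⟩ :=
    exists_string l fun z => if z < len c then Bit c z else if O z then A z else X z
  refine ⟨q, fun z hz hO => ?_, ⟨hq ▸ hl, fun z hz => ?_⟩, hq, fun z h1 h2 h3 => ?_⟩
  · rw [hb z (hq ▸ hz)]
    split_ifs with h
    · exact hc z h hO
    · exact Iff.rfl
  · rw [hb z (hz.trans_le hl), if_pos hz]
  · rw [hb z h2, if_neg h1.not_gt, if_neg h3]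

/-- An arithmetic sequence of dense open sets of admissible strings. -/
structure IsDenseFamily (O A : ℕ → Prop) (E : ℕ → ℕ → Prop) : Prop where
  ar : Ar₂ E
  mono : ∀ {i c q}, Adm O A q → Ext q c → E i c → E i q
  dense : ∀ i {c}, Adm O A c → ∃ q, Adm O A q ∧ Ext q c ∧ E i q

/-- The set `G` meets every member of the family `E`. -/
def Meets (G : Set ℕ) (E : ℕ → ℕ → Prop) : Prop := ∀ i, ∃ c, Approx G c ∧ E i c

/-- `Fr` is an arithmetic forcing relation for the property `Q`, with the truth lemma holding for
all sets that meet the family `E`. -/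
structure IsForcing (O A : ℕ → Prop) (Q : Set ℕ → ℕ → Prop) (Fr E : ℕ → ℕ → Prop) : Prop where
  ar : Ar₂ Fr
  mono : ∀ {i c q}, Adm O A q → Ext q c → Fr i c → Fr i q
  family : IsDenseFamily O A E
  truth : ∀ {G}, Compat O A G → Meets G E → ∀ i, Q G i ↔ ∃ c, Approx G c ∧ Fr i c

/-- The property `Q` admits an arithmetic forcing relation. -/
def Forceable (O A : ℕ → Prop) (Q : Set ℕ → ℕ → Prop) : Prop := ∃ Fr E, IsForcing O A Q Fr E

/-- No admissible extension of `c` satisfies `D`. -/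
def Refutes (O A : ℕ → Prop) (D : ℕ → Prop) (c : ℕ) : Prop :=
  ∀ q, Adm O A q → Ext q c → ¬ D q

section Forcing

variable {O A : ℕ → Prop} {Q Q' : Set ℕ → ℕ → Prop} {E E' Fr : ℕ → ℕ → Prop}

theorem IsDenseFamily.true : IsDenseFamily O A fun _ _ => True :=
  ⟨(arFun_zero.eq arFun_zero).congr fun _ => by simp, fun _ _ _ => trivial,
    fun _ c hc => ⟨c, hc, Ext.refl c, trivial⟩⟩

theorem IsDenseFamily.and (h : IsDenseFamily O A E) (h' : IsDenseFamily O A E') :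
    IsDenseFamily O A fun i c => E i c ∧ E' i c where
  ar := Ar.and h.ar h'.ar
  mono hq hqc hc := ⟨h.mono hq hqc hc.1, h'.mono hq hqc hc.2⟩
  dense i c hc := by
    obtain ⟨q, hq, hqc, hE⟩ := h.dense i hc
    obtain ⟨r, hr, hrq, hE'⟩ := h'.dense i hq
    exact ⟨r, hr, hrq.trans hqc, h.mono hr hrq hE, hE'⟩

theorem Meets.left {G : Set ℕ} (h : Meets G fun i c => E i c ∧ E' i c) : Meets G E :=
  fun i => (h i).imp fun _ hc => ⟨hc.1, hc.2.1⟩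

theorem Meets.right {G : Set ℕ} (h : Meets G fun i c => E i c ∧ E' i c) : Meets G E' :=
  fun i => (h i).imp fun _ hc => ⟨hc.1, hc.2.2⟩

theorem Refutes.mono {D : ℕ → Prop} {c q : ℕ} (h : Refutes O A D c) (hqc : Ext q c) :
    Refutes O A D q :=
  fun r hr hrq => h r hr (hrq.trans hqc)

theorem Ar₂.refutes (hO : Ar₁ O) (hA : Ar₁ A) (hF : Ar₂ Fr) :
    Ar₂ fun i c => Refutes O A (Fr i) c :=
  Ar.all <| ((hO.adm hA).comp (arFun_var _)).imp <|
    (ar₂_ext.comp (arFun_var _) (arFun_var _)).imp (hF.comp (arFun_var _) (arFun_var _)).not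

theorem IsForcing.decides (hO : Ar₁ O) (hA : Ar₁ A) (h : IsForcing O A Q Fr E) :
    IsDenseFamily O A fun i c => Fr i c ∨ Refutes O A (Fr i) c where
  ar := Ar.or h.ar (h.ar.refutes hO hA)
  mono hq hqc := Or.imp (h.mono hq hqc) fun hr => hr.mono hqc
  dense i c hc := by
    by_cases hr : Refutes O A (Fr i) c
    · exact ⟨c, hc, Ext.refl c, Or.inr hr⟩
    · unfold Refutes at hr
      push Not at hr
      obtain ⟨q, hq, hqc, hF⟩ := hr
      exact ⟨q, hq, hqc, Or.inl hF⟩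

theorem IsForcing.not_of_refutes (h : IsForcing O A Q Fr E) {G : Set ℕ} (hG : Compat O A G)
    (hE : Meets G E) {i c : ℕ} (hc : Approx G c) (hr : Refutes O A (Fr i) c) : ¬ Q G i := by
  rw [h.truth hG hE]
  rintro ⟨p, hp, hF⟩
  obtain ⟨q, hq, hqp, hqc⟩ := hp.directed hc
  exact hr q (hq.adm hG) hqc (h.mono (hq.adm hG) hqp hF)

theorem Forceable.const {X : ℕ → Prop} (hX : Ar₁ X) : Forceable O A fun _ i => X i := by
  refine ⟨fun i _ => X i, fun _ _ => True, hX.comp (arFun_var _), fun _ _ h => h,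
    .true, fun {G} _ _ i => ⟨fun h => ?_, fun ⟨_, _, h⟩ => h⟩⟩
  obtain ⟨c, hc, -⟩ := exists_approx G 0
  exact ⟨c, hc, h⟩

theorem Forceable.mem {t : ℕ → ℕ} (ht : ArFun₁ t) : Forceable O A fun G i => t i ∈ G := by
  have ht' : ArFun fun v : Fin 2 → ℕ => t (v 0) := ht.comp (arFun_var _)
  refine ⟨fun i c => t i < len c ∧ Bit c (t i), fun _ _ => True,
    (ht'.lt (arFun_var _).len).and ((arFun_var _).bit ht'),
    fun _ hqc h => ⟨h.1.trans_le hqc.1, (hqc.2 _ h.1).mpr h.2⟩,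
    .true, fun {G} _ _ i => ⟨fun h => ?_, fun ⟨_, hc, h⟩ => (hc _ h.1).mp h.2⟩⟩
  obtain ⟨c, hc, hl⟩ := exists_approx G (t i + 1)
  have hlt : t i < len c := by omega
  exact ⟨c, hc, hlt, (hc _ hlt).mpr h⟩

theorem Forceable.imp (hO : Ar₁ O) (hA : Ar₁ A) (hQ : Forceable O A Q)
    (hQ' : Forceable O A Q') : Forceable O A fun G i => Q G i → Q' G i := by
  obtain ⟨Fr, E, h⟩ := hQ
  obtain ⟨Fr', E', h'⟩ := hQ'
  refine ⟨fun i c => ∀ q, Adm O A q → Ext q c → Fr i q → Fr' i q, _, ?_, ?_,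
    (h.family.and h'.family).and (h.decides hO hA), ?_⟩
  · exact Ar.all <| ((hO.adm hA).comp (arFun_var _)).imp <|
      (ar₂_ext.comp (arFun_var _) (arFun_var _)).imp <|
        (h.ar.comp (arFun_var _) (arFun_var _)).imp (h'.ar.comp (arFun_var _) (arFun_var _))
  · exact fun _ hqc hF r hr hrq => hF r hr (hrq.trans hqc)
  · intro G hG hE i
    constructor
    · intro hi
      obtain ⟨c, hc, -, hd⟩ := hE i
      rcases hd with hd | hd
      · obtain ⟨p, hp, hF⟩ := (h'.truth hG hE.left.right i).mp
          (hi ((h.truth hG hE.left.left i).mpr ⟨c, hc, hd⟩))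
        exact ⟨p, hp, fun q hq hqp _ => h'.mono hq hqp hF⟩
      · exact ⟨c, hc, fun q hq hqc hF => absurd hF (hd q hq hqc)⟩
    · rintro ⟨c, hc, hF⟩ hi
      obtain ⟨p, hp, hFp⟩ := (h.truth hG hE.left.left i).mp hi
      obtain ⟨q, hq, hqp, hqc⟩ := hp.directed hc
      exact (h'.truth hG hE.left.right i).mpr
        ⟨q, hq, hF q (hq.adm hG) hqc (h.mono (hq.adm hG) hqp hFp)⟩

theorem Forceable.all (hO : Ar₁ O) (hA : Ar₁ A) (hQ : Forceable O A Q)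
    {R : ℕ → ℕ → Prop} (hR : Ar₂ R) : Forceable O A fun G i => ∀ j, R i j → Q G j := by
  obtain ⟨Fr, E, h⟩ := hQ
  set Fr' : ℕ → ℕ → Prop := fun i c =>
    ∀ j, R i j → ∀ q, Adm O A q → Ext q c → ∃ r, Adm O A r ∧ Ext r q ∧ Fr j r with hFr'
  have hAr : Ar₂ Fr' :=
    Ar.all <| (hR.comp (arFun_var _) (arFun_var _)).imp <| Ar.all <|
      ((hO.adm hA).comp (arFun_var _)).imp <| (ar₂_ext.comp (arFun_var _) (arFun_var _)).imp <|
        Ar.ex <| ((hO.adm hA).comp (arFun_var _)).and <|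
          (ar₂_ext.comp (arFun_var _) (arFun_var _)).and <| h.ar.comp (arFun_var _) (arFun_var _)
  have hmono : ∀ {i c q}, Adm O A q → Ext q c → Fr' i c → Fr' i q :=
    fun _ hqc hF j hj r hr hrq => hF j hj r hr (hrq.trans hqc)
  have hfam : IsDenseFamily O A fun i c => Fr' i c ∨ ∃ j, R i j ∧ Refutes O A (Fr j) c := by
    refine ⟨Ar.or hAr (Ar.ex ?_), fun hq hqc => Or.imp (hmono hq hqc) ?_, fun i c hc => ?_⟩
    · exact (hR.comp (arFun_var _) (arFun_var _)).and <|
        (h.ar.refutes hO hA).comp (arFun_var _) (arFun_var _)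
    · exact fun ⟨j, hj, hr⟩ => ⟨j, hj, hr.mono hqc⟩
    · by_cases hF : Fr' i c
      · exact ⟨c, hc, Ext.refl c, Or.inl hF⟩
      · simp only [hFr'] at hF
        push Not at hF
        obtain ⟨j, hj, q, hq, hqc, hF⟩ := hF
        exact ⟨q, hq, hqc, Or.inr ⟨j, hj, hF⟩⟩
  refine ⟨Fr', _, hAr, hmono, (h.family.and (h.decides hO hA)).and hfam, fun {G} hG hE i => ?_⟩
  have htruth := h.truth hG hE.left.left
  constructor
  · intro hi
    obtain ⟨c, hc, -, hd | ⟨j, hj, hd⟩⟩ := hE i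
    · exact ⟨c, hc, hd⟩
    · exact absurd (hi j hj) (h.not_of_refutes hG hE.left.left hc hd)
  · rintro ⟨c, hc, hF⟩ j hj
    obtain ⟨p, hp, hd | hd⟩ := hE.left.right j
    · exact (htruth j).mpr ⟨p, hp, hd⟩
    · obtain ⟨q, hq, hqp, hqc⟩ := hp.directed hc
      obtain ⟨r, hr, hrq, hFr⟩ := hF j hj q (hq.adm hG) hqc
      exact absurd hFr (hd r hr (hrq.trans hqp))

end Forcing

section Formulas

variable {O A : ℕ → Prop}

/-- The set of pairs whose codes lie in `G`. -/
def decode (G : Set ℕ) : Set (ℕ × ℕ) := {p | Nat.pair p.1 p.2 ∈ G}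

/-- The valuation of the free variable and the first `n` bound variables coded by `i`. -/
def valuation (n i : ℕ) : Fin 1 ⊕ Fin n → ℕ :=
  Sum.elim (fun _ => Nat.beta i 0) fun j => Nat.beta i (j + 1)

theorem Forceable.congr {Q Q' : Set ℕ → ℕ → Prop} (hQ : Forceable O A Q)
    (h : ∀ G i, Q' G i ↔ Q G i) : Forceable O A Q' := by
  rwa [show Q' = Q from funext₂ fun G i => propext (h G i)]

theorem exists_arFun₁_realize {n : ℕ} (t : (Larith.sum Lb).Term (Fin 1 ⊕ Fin n)) :
    ∃ f, ArFun₁ f ∧ ∀ B i,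
      @Term.realize (Larith.sum Lb) ℕ (bStructure B) _ (valuation n i) t = f i := by
  induction t with
  | var x =>
    rcases x with x | x
    · exact ⟨fun i => Nat.beta i 0, (arFun_var _).beta arFun_zero, fun _ _ => rfl⟩
    · exact ⟨fun i => Nat.beta i (x + 1), (arFun_var _).beta (arFun_const _), fun _ _ => rfl⟩
  | func F ts ih =>
    choose f hf hft using ih
    rcases F with F | F
    · cases F with
      | zero => exact ⟨fun _ => 0, arFun_zero, fun _ _ => rfl⟩
      | one => exact ⟨fun _ => 1, arFun_one, fun _ _ => rfl⟩
      | add =>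
        exact ⟨fun i => f 0 i + f 1 i, ArFun.add (hf 0) (hf 1),
          fun B i => congr_arg₂ (· + ·) (hft 0 B i) (hft 1 B i)⟩
      | mul =>
        exact ⟨fun i => f 0 i * f 1 i, ArFun.mul (hf 0) (hf 1),
          fun B i => congr_arg₂ (· * ·) (hft 0 B i) (hft 1 B i)⟩
    · exact F.elim

theorem forall_snoc_iff {n i : ℕ} {T : (Fin 1 → ℕ) → (Fin (n + 1) → ℕ) → Prop} :
    (∀ x : ℕ, T (fun _ => Nat.beta i 0)
      (Fin.snoc (α := fun _ => ℕ) (fun k : Fin n => Nat.beta i (k + 1)) x)) ↔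
      ∀ j, (∀ k, k < n + 1 → Nat.beta i k = Nat.beta j k) →
        T (fun _ => Nat.beta j 0) fun k : Fin (n + 1) => Nat.beta j (k + 1) := by
  have key : ∀ j, (∀ k, k < n + 1 → Nat.beta i k = Nat.beta j k) →
      (fun k : Fin (n + 1) => Nat.beta j (k + 1)) =
        Fin.snoc (α := fun _ => ℕ) (fun k : Fin n => Nat.beta i (k + 1))
          (Nat.beta j (n + 1)) := by
    intro j hj
    funext k
    refine Fin.lastCases ?_ (fun k => ?_) k
    · simp
    · simp [hj (k + 1) (by omega)]
  constructor
  · intro h j hj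
    rw [key j hj, ← hj 0 (Nat.succ_pos n)]
    exact h _
  · intro h x
    obtain ⟨j, hj⟩ := exists_beta (n + 2) fun k => if k < n + 1 then Nat.beta i k else x
    have hj' : ∀ k, k < n + 1 → Nat.beta i k = Nat.beta j k := fun k hk => by
      rw [hj k (by omega), if_pos hk]
    have := h j hj'
    rwa [key j hj', ← hj' 0 (Nat.succ_pos n), hj (n + 1) (by omega), if_neg (lt_irrefl _)] at this

/-- Satisfaction in `⟨ℕ, +, ·, 0, 1, <, B⟩` admits an arithmetic forcing relation. -/
theorem forceable_realize (hO : Ar₁ O) (hA : Ar₁ A) {n : ℕ}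
    (φ : (Larith.sum Lb).BoundedFormula (Fin 1) n) :
    Forceable O A fun G i =>
      @BoundedFormula.Realize (Larith.sum Lb) ℕ (bStructure (decode G)) _ _ φ
        (fun _ => Nat.beta i 0) fun k => Nat.beta i (k + 1) := by
  induction φ with
  | falsum =>
    have hF : Ar₁ fun _ => False := (arFun_zero.eq arFun_one).congr fun _ => by simp
    exact (Forceable.const hF).congr fun _ _ => Iff.rfl
  | equal t₁ t₂ =>
    obtain ⟨f, hf, hft⟩ := exists_arFun₁_realize t₁
    obtain ⟨g, hg, hgt⟩ := exists_arFun₁_realize t₂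
    refine (Forceable.const (X := fun i => f i = g i) (ArFun.eq hf hg)).congr fun G i => ?_
    rw [← hft (decode G) i, ← hgt (decode G) i]
    exact Iff.rfl
  | rel R ts =>
    choose f hf hft using fun k => exists_arFun₁_realize (ts k)
    rcases R with R | R
    · cases R
      refine (Forceable.const (X := fun i => f 0 i < f 1 i) (ArFun.lt (hf 0) (hf 1))).congr
        fun G i => ?_
      rw [← hft 0 (decode G) i, ← hft 1 (decode G) i]
      exact Iff.rfl
    · have hk := PLift.down R
      subst hk
      refine (Forceable.mem (t := fun i => Nat.pair (f 0 i) (f 1 i))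
        (ArFun.pair (hf 0) (hf 1))).congr fun G i => ?_
      rw [← hft 0 (decode G) i, ← hft 1 (decode G) i]
      exact Iff.rfl
  | imp _ _ ih₁ ih₂ => exact ih₁.imp hO hA ih₂
  | all φ ih =>
    refine (ih.all hO hA (R := fun i j => ∀ k, k < _ + 1 → Nat.beta i k = Nat.beta j k) ?_).congr
      fun G i => forall_snoc_iff (T := fun v xs =>
        @BoundedFormula.Realize (Larith.sum Lb) ℕ (bStructure (decode G)) _ _ φ v xs)
    exact Ar.all <| ((arFun_var _).lt (arFun_const _)).imp <|
      ((arFun_var _).beta (arFun_var _)).eq ((arFun_var _).beta (arFun_var _))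

end Formulas

section Generic

/-- An arithmetic sequence of dense sets of strings is met by an arithmetic set extending any
given string. -/
theorem exists_arithmetic_generic {E : ℕ → ℕ → Prop} (hE : Ar₂ E)
    (hd : ∀ i c, ∃ q, Ext q c ∧ E i q) (c : ℕ) :
    ∃ G : ℕ → Prop, Ar₁ G ∧ Approx {z | G z} c ∧ Meets {z | G z} E := by
  classical
  let step : ℕ → ℕ → ℕ → Prop := fun i u v =>
    (Ext v u ∧ E i v) ∧ ∀ w, w < v → ¬ (Ext w u ∧ E i w)
  let path : ℕ → ℕ → Prop := fun i s =>
    Nat.beta s 0 = c ∧ ∀ j, j < i → step j (Nat.beta s j) (Nat.beta s (j + 1))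
  let r : ℕ → ℕ := fun n => Nat.rec c (fun i u => Nat.find (hd i u)) n
  have hstep : ∀ i u v, step i u v ↔ v = Nat.find (hd i u) := fun i u v => by
    rw [eq_comm, Nat.find_eq_iff]
  have hr : ∀ i, step i (r i) (r (i + 1)) := fun i => (hstep _ _ _).mpr rfl
  have hpath : ∀ {i s}, path i s → ∀ j, j ≤ i → Nat.beta s j = r j := by
    intro i s hs j
    induction j with
    | zero => exact fun _ => hs.1
    | succ j ih =>
      intro hj
      have := hs.2 j hj
      rw [ih (by omega)] at this
      exact (hstep _ _ _).mp this
  have hpath' : ∀ i, ∃ s, path i s := by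
    intro i
    obtain ⟨s, hs⟩ := exists_beta (i + 1) r
    refine ⟨s, hs 0 (by omega), fun j hj => ?_⟩
    rw [hs j (by omega), hs (j + 1) (by omega)]
    exact hr j
  have hext : ∀ i k, Ext (r (i + k)) (r i) := by
    intro i k
    induction k with
    | zero => exact Ext.refl _
    | succ k ih => exact (hr (i + k)).1.1.trans ih
  let G : ℕ → Prop := fun z =>
    ∃ i s, path i s ∧ z < len (Nat.beta s i) ∧ Bit (Nat.beta s i) z
  have hG : ∀ z, G z ↔ ∃ i, z < len (r i) ∧ Bit (r i) z := by
    refine fun z => exists_congr fun i => ⟨fun ⟨s, hs, h⟩ => ?_, fun h => ?_⟩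
    · rwa [hpath hs i le_rfl] at h
    · obtain ⟨s, hs⟩ := hpath' i
      exact ⟨s, hs, by rwa [hpath hs i le_rfl]⟩
  have happrox : ∀ i, Approx {z | G z} (r i) := by
    intro i z hz
    change _ ↔ G z
    rw [hG]
    refine ⟨fun h => ⟨i, hz, h⟩, fun ⟨j, hj, h⟩ => ?_⟩
    rcases le_total i j with hij | hij <;> obtain ⟨k, rfl⟩ := Nat.exists_eq_add_of_le hij
    · exact ((hext i k).2 z hz).mp h
    · exact ((hext j k).2 z hj).mpr h
  refine ⟨G, ?_, happrox 0, fun i => ⟨r (i + 1), happrox (i + 1), (hr i).1.2⟩⟩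
  refine Ar.ex <| Ar.ex <| Ar.and (Ar.and ?_ <| Ar.all <| Ar.imp ?_ <|
    Ar.and (Ar.and ?_ ?_) <| Ar.all <| Ar.imp ?_ (Ar.and ?_ ?_).not) (Ar.and ?_ ?_)
  · exact ((arFun_var _).beta arFun_zero).eq (arFun_const c)
  · exact (arFun_var _).lt (arFun_var _)
  · exact ar₂_ext.comp ((arFun_var _).beta ((arFun_var _).add arFun_one))
      ((arFun_var _).beta (arFun_var _))
  · exact hE.comp (arFun_var _) ((arFun_var _).beta ((arFun_var _).add arFun_one))
  · exact (arFun_var _).lt ((arFun_var _).beta ((arFun_var _).add arFun_one))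
  · exact ar₂_ext.comp (arFun_var _) ((arFun_var _).beta (arFun_var _))
  · exact hE.comp (arFun_var _) (arFun_var _)
  · exact (arFun_var _).lt ((arFun_var _).beta (arFun_var _)).len
  · exact ((arFun_var _).beta (arFun_var _)).bit (arFun_var _)

variable {O A : ℕ → Prop} {E : ℕ → ℕ → Prop}

/-- The column of the plane containing the pair coded by `z`. -/
def column (z : ℕ) : ℕ := (Nat.unpair z).1

/-- A free column can be fixed to be an arithmetic set in such a way that a given family stays
dense. -/
theorem IsDenseFamily.exists_fix_column (hO : Ar₁ O) (hA : Ar₁ A) (h : IsDenseFamily O A E)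
    {m : ℕ} (hm : ∀ z, O z → column z ≠ m) (c : ℕ) :
    ∃ G : ℕ → Prop, Ar₁ G ∧ Approx {z | G z} c ∧
      IsDenseFamily (fun z => O z ∨ column z = m)
        (fun z => (column z = m ∧ G z) ∨ (column z ≠ m ∧ A z)) E := by
  let H : ℕ → ℕ → Prop := fun j r => Adm O A (Nat.unpair j).2 →
    (∃ z, (z < len (Nat.unpair j).2 ∧ z < len r) ∧ column z = m ∧
      ¬ (Bit (Nat.unpair j).2 z ↔ Bit r z)) ∨
    ∃ e, (Adm O A e ∧ Ext e (Nat.unpair j).2) ∧ (E (Nat.unpair j).1 e ∧ len e ≤ len r) ∧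
      ∀ z, z < len e → column z = m → (Bit e z ↔ Bit r z)
  have hcol : ∀ {α : Type} (i : α), Ar fun v : α → ℕ => column (v i) = m := fun i =>
    (arFun_var i).unpair_fst.eq (arFun_const m)
  have hH : Ar₂ H := by
    refine Ar.imp ?_ <| Ar.or (Ar.ex <| Ar.and (Ar.and ?_ ?_) (Ar.and (hcol _) (Ar.iff ?_ ?_).not))
      (Ar.ex <| Ar.and (Ar.and ?_ ?_) <| Ar.and (Ar.and ?_ ?_) <| Ar.all <| Ar.imp ?_ <|
        Ar.imp (hcol _) <| Ar.iff ?_ ?_)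
    · exact (hO.adm hA).comp (arFun_var _).unpair_snd
    · exact (arFun_var _).lt (arFun_var _).unpair_snd.len
    · exact (arFun_var _).lt (arFun_var _).len
    · exact (arFun_var _).unpair_snd.bit (arFun_var _)
    · exact (arFun_var _).bit (arFun_var _)
    · exact (hO.adm hA).comp (arFun_var _)
    · exact ar₂_ext.comp (arFun_var _) (arFun_var _).unpair_snd
    · exact h.ar.comp (arFun_var _).unpair_fst (arFun_var _)
    · exact (arFun_var _).len.le (arFun_var _).len
    · exact (arFun_var _).lt (arFun_var _).len
    · exact (arFun_var _).bit (arFun_var _)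
    · exact (arFun_var _).bit (arFun_var _)
  have hd : ∀ j r, ∃ q, Ext q r ∧ H j q := by
    intro j r
    have hno : ∀ p, Adm (fun _ => False) A p := fun _ _ _ h => h.elim
    set p := (Nat.unpair j).2 with hp
    obtain ⟨r₁, -, hr₁, hl₁, -⟩ := (hno r).exists_ext (le_max_left _ (len p)) fun _ => True
    by_cases hadm : Adm O A p
    swap
    · exact ⟨r₁, hr₁, fun h => absurd h hadm⟩
    by_cases hclash : ∃ z, (z < len p ∧ z < len r₁) ∧ column z = m ∧ ¬ (Bit p z ↔ Bit r₁ z)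
    · exact ⟨r₁, hr₁, fun _ => Or.inl hclash⟩
    have hle : len p ≤ len r₁ := hl₁ ▸ le_max_right _ _
    obtain ⟨p', hp', hext, hl, hb⟩ := hadm.exists_ext hle (Bit r₁)
    obtain ⟨e, he, hep, hEe⟩ := h.dense (Nat.unpair j).1 hp'
    have hle' : len r₁ ≤ len e := hl ▸ hep.1
    obtain ⟨r₂, -, hr₂, hl₂, hb₂⟩ := (hno r₁).exists_ext hle' (Bit e)
    refine ⟨r₂, hr₂.trans hr₁, fun _ => Or.inr ⟨e, ⟨he, hep.trans hext⟩, ⟨hEe, hl₂.ge⟩,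
      fun z hz hzm => ?_⟩⟩
    rcases lt_or_ge z (len r₁) with hlt | hge
    · rw [hr₂.2 z hlt, hep.2 z (hl ▸ hlt)]
      rcases lt_or_ge z (len p) with hlt' | hge'
      · rw [hext.2 z hlt']
        by_contra hne
        exact hclash ⟨z, ⟨hlt', hlt⟩, hzm, hne⟩
      · exact hb z hge' hlt fun hOz => hm z hOz hzm
    · exact (hb₂ z hge hz id).symm
  obtain ⟨G, hG, hGc, hGH⟩ := exists_arithmetic_generic hH hd c
  have hadm : ∀ {q}, Adm (fun z => O z ∨ column z = m)
      (fun z => (column z = m ∧ G z) ∨ (column z ≠ m ∧ A z)) q ↔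
      Adm O A q ∧ ∀ z, z < len q → column z = m → (Bit q z ↔ G z) := by
    refine fun {q} => ⟨fun hq => ⟨fun z hz hOz => ?_, fun z hz hzm => ?_⟩,
      fun hq z hz hOz => ?_⟩
    · rw [hq z hz (Or.inl hOz)]
      simp [hm z hOz]
    · rw [hq z hz (Or.inr hzm)]
      simp [hzm]
    · by_cases hzm : column z = m
      · rw [hq.2 z hz hzm]
        simp [hzm]
      · rw [hq.1 z hz (hOz.resolve_right hzm)]
        simp [hzm]
  refine ⟨G, hG, hGc, h.ar, fun hq => h.mono (hadm.mp hq).1, fun i p hp => ?_⟩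
  obtain ⟨hp, hpm⟩ := hadm.mp hp
  obtain ⟨r, hr, hHr⟩ := hGH (Nat.pair i p)
  simp only [H, Nat.unpair_pair] at hHr
  rcases hHr hp with ⟨z, ⟨hz, hz'⟩, hzm, hne⟩ | ⟨e, ⟨he, hep⟩, ⟨hEe, hl⟩, hb⟩
  · exact absurd ((hpm z hz hzm).trans (hr z hz').symm) hne
  · exact ⟨e, hadm.mpr ⟨he, fun z hz hzm => (hb z hz hzm).trans (hr z (hz.trans_le hl))⟩,
      hep, hEe⟩

end Generic

section Construction

/-- The data built up after `m` stages of the construction: an initial segment `c` of the final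
set, the values `A` of the final set on the positions `O` decided so far, and a family `E` that
the final set has to meet. -/
structure Stage (m : ℕ) where
  c : ℕ
  O : ℕ → Prop
  A : ℕ → Prop
  E : ℕ → ℕ → Prop
  arO : Ar₁ O
  arA : Ar₁ A
  adm : Adm O A c
  family : IsDenseFamily O A E
  column_lt : ∀ z, O z → column z < m

/-- The string, the decided positions and the family grow from one stage to another. -/
structure Stage.Le {m n : ℕ} (s : Stage m) (t : Stage n) : Prop where
  ext : Ext t.c s.c
  agree : ∀ z, s.O z → t.O z ∧ (t.A z ↔ s.A z)
  family : ∀ i c, t.E i c → s.E i c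

/-- The set `G` satisfies all the constraints imposed by the stage `s`. -/
structure Stage.Admits {m : ℕ} (s : Stage m) (G : Set ℕ) : Prop where
  compat : Compat s.O s.A G
  meets : Meets G s.E
  approx : Approx G s.c

theorem Stage.Le.refl {m : ℕ} (s : Stage m) : s.Le s :=
  ⟨Ext.refl _, fun _ h => ⟨h, Iff.rfl⟩, fun _ _ h => h⟩

theorem Stage.Le.trans {k m n : ℕ} {s : Stage k} {t : Stage m} {u : Stage n}
    (h : s.Le t) (h' : t.Le u) : s.Le u where
  ext := h'.ext.trans h.ext
  agree z hz :=
    have ht := h.agree z hz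
    ⟨(h'.agree z ht.1).1, (h'.agree z ht.1).2.trans ht.2⟩
  family i c hc := h.family i c (h'.family i c hc)

theorem Stage.Admits.of_le {m n : ℕ} {s : Stage m} {t : Stage n} {G : Set ℕ}
    (hG : t.Admits G) (h : s.Le t) : s.Admits G where
  compat z hz := (hG.compat z (h.agree z hz).1).trans (h.agree z hz).2
  meets i := (hG.meets i).imp fun c hc => ⟨hc.1, h.family i c hc.2⟩
  approx := hG.approx.of_ext h.ext

/-- Column `m` is decided so as to disagree with the property `Q · i` about being arithmetic. -/
theorem Stage.exists_diagonalize {m : ℕ} (s : Stage m) {Q : Set ℕ → ℕ → Prop} (i : ℕ)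
    (hQ : ∀ {O A}, Ar₁ O → Ar₁ A → Forceable O A Q) :
    ∃ t : Stage (m + 1), s.Le t ∧ (∀ z, t.O z → s.O z ∨ column z = m) ∧
      (((∀ z, t.O z → column z ≠ m) ∧ ∀ G, t.Admits G → Q G i) ∨
        ∀ G, t.Admits G → Ar₁ (fun y => Nat.pair m y ∈ G) ∧ ¬ Q G i) := by
  obtain ⟨Fr, E, hF⟩ := hQ s.arO s.arA
  have hfam := s.family.and hF.family
  have hne : ∀ z, s.O z → column z ≠ m := fun z hz => (s.column_lt z hz).ne
  by_cases hr : Refutes s.O s.A (Fr i) s.c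
  · obtain ⟨G₀, hG₀, happ, hfix⟩ := hfam.exists_fix_column s.arO s.arA hne s.c
    have hcol : Ar fun v : Fin 1 → ℕ => column (v 0) = m :=
      (arFun_var _).unpair_fst.eq (arFun_const m)
    let t : Stage (m + 1) :=
      { c := s.c
        O := fun z => s.O z ∨ column z = m
        A := fun z => (column z = m ∧ G₀ z) ∨ (column z ≠ m ∧ s.A z)
        E := _
        arO := Ar.or s.arO hcol
        arA := Ar.or (Ar.and hcol hG₀) (Ar.and hcol.not s.arA)
        adm := fun z hz hO => by
          by_cases hzm : column z = m
          · simpa [hzm] using happ z hz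
          · simpa [hzm] using s.adm z hz (hO.resolve_right hzm)
        family := hfix
        column_lt := fun z hz => hz.elim (fun h => (s.column_lt z h).trans m.lt_succ_self)
          fun h => h ▸ m.lt_succ_self }
    have hst : s.Le t :=
      ⟨Ext.refl _, fun z hz => ⟨Or.inl hz, by simp [t, hne z hz]⟩, fun _ _ h => h.1⟩
    refine ⟨t, hst, fun z hz => hz, Or.inr fun G hG => ⟨?_, ?_⟩⟩
    · have hmem : ∀ y, Nat.pair m y ∈ G ↔ G₀ (Nat.pair m y) := fun y => by
        have hy : column (Nat.pair m y) = m := by simp [column]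
        have := hG.compat (Nat.pair m y) (Or.inr hy)
        simpa [t, hy] using this
      exact (hG₀.comp ((arFun_const m).pair (arFun_var _))).congr fun _ => hmem _
    · exact hF.not_of_refutes (hG.of_le hst).compat hG.meets.right hG.approx hr
  · unfold Refutes at hr
    push Not at hr
    obtain ⟨q, hq, hqc, hFq⟩ := hr
    let t : Stage (m + 1) :=
      { s with
        c := q
        E := _
        adm := hq
        family := hfam
        column_lt := fun z hz => (s.column_lt z hz).trans m.lt_succ_self }
    have hst : s.Le t := ⟨hqc, fun z hz => ⟨hz, Iff.rfl⟩, fun _ _ h => h.1⟩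
    exact ⟨t, hst, fun z hz => Or.inl hz, Or.inl ⟨fun z hz => hne z hz, fun G hG =>
      (hF.truth hG.compat hG.meets.right i).mpr ⟨q, hG.approx, hFq⟩⟩⟩

/-- The string of a stage can be extended so as to meet a member of the family, to be long and to
make a column that is still free differ from a given set. -/
theorem Stage.exists_extend {m : ℕ} (s : Stage m) (i x l : ℕ) (X : ℕ → Prop) :
    ∃ t : Stage m, s.Le t ∧ (∀ z, t.O z → s.O z) ∧ t.E i t.c ∧ l ≤ len t.c ∧
      ((∀ z, t.O z → column z ≠ x) → ∀ G, Approx G t.c → ∃ y, ¬ (Nat.pair x y ∈ G ↔ X y)) := by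
  obtain ⟨e, he, hec, hE⟩ := s.family.dense i s.adm
  have hy : len e ≤ Nat.pair x (len e) := Nat.right_le_pair _ _
  obtain ⟨q, hq, hqe, hl, hb⟩ := he.exists_ext
    (l := Nat.pair x (len e) + 1 + l) (by omega) fun z => ¬ X (Nat.unpair z).2
  refine ⟨{ s with c := q, adm := hq }, ⟨hqe.trans hec, fun z hz => ⟨hz, Iff.rfl⟩,
    fun _ _ h => h⟩, fun _ h => h, s.family.mono hq hqe hE, ?_, fun hO G hG => ?_⟩
  · change l ≤ len q
    omega
  · refine ⟨len e, ?_⟩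
    have hlt : Nat.pair x (len e) < Nat.pair x (len e) + 1 + l := by omega
    have h₁ := hb _ hy hlt fun h => hO _ h (by simp [column])
    have h₂ := hG (Nat.pair x (len e)) (show _ < len q by omega)
    simp only [Nat.unpair_pair] at h₁
    rw [← h₂]
    change ¬ (Bit q _ ↔ _)
    tauto

/-- The stage before any requirement has been considered. -/
def initialStage : Stage 0 where
  c := 0
  O _ := False
  A _ := False
  E _ _ := True
  arO := (arFun_zero.eq arFun_one).congr fun _ => by simp
  arA := (arFun_zero.eq arFun_one).congr fun _ => by simp
  adm _ _ h := h.elim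
  family := .true
  column_lt _ h := h.elim

/-- A set of codes of pairs whose column `m` is arithmetic exactly if the `m`-th of countably many
forceable properties fails at `m`. -/
theorem exists_diagonal_set (Q : ℕ → Set ℕ → ℕ → Prop) (ι : ℕ → ℕ)
    (hQ : ∀ m {O A}, Ar₁ O → Ar₁ A → Forceable O A (Q m)) (X : ℕ → ℕ → Prop) :
    ∃ G : Set ℕ, ∀ m,
      (Q m G (ι m) ∧ ∀ j, ∃ y, ¬ (Nat.pair m y ∈ G ↔ X j y)) ∨
        (Ar₁ (fun y => Nat.pair m y ∈ G) ∧ ¬ Q m G (ι m)) := by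
  have hstep : ∀ m (s : Stage m), ∃ t : Stage (m + 1), s.Le t ∧
      (∀ z, t.O z → s.O z ∨ column z = m) ∧ t.E (Nat.unpair m).2 t.c ∧ m < len t.c ∧
      ((∀ z, t.O z → column z ≠ (Nat.unpair m).1) → ∀ G, Approx G t.c →
        ∃ y, ¬ (Nat.pair (Nat.unpair m).1 y ∈ G ↔ X (Nat.unpair m).2 y)) ∧
      (((∀ z, t.O z → column z ≠ m) ∧ ∀ G, t.Admits G → Q m G (ι m)) ∨
        ∀ G, t.Admits G → Ar₁ (fun y => Nat.pair m y ∈ G) ∧ ¬ Q m G (ι m)) := by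
    intro m s
    obtain ⟨t, hst, hO, hdiag⟩ := s.exists_diagonalize (ι m) (hQ m)
    obtain ⟨u, htu, hO', hE, hl, hX⟩ := t.exists_extend (Nat.unpair m).2 (Nat.unpair m).1
      (m + 1) (X (Nat.unpair m).2)
    refine ⟨u, hst.trans htu, fun z hz => hO z (hO' z hz), hE, hl, hX, hdiag.imp
      (fun h => ⟨fun z hz => h.1 z (hO' z hz), fun G hG => h.2 G (hG.of_le htu)⟩)
      fun h G hG => h G (hG.of_le htu)⟩
  choose next hle hO hE hl hX hdiag using hstep
  let S : ∀ m, Stage m := fun m => Nat.rec initialStage (fun m s => next m s) m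
  have hS : ∀ m k, (S m).Le (S (m + k)) := by
    intro m k
    induction k with
    | zero => exact Stage.Le.refl _
    | succ k ih => exact ih.trans (hle _ _)
  let G : Set ℕ := {z | Bit (S (z + 1)).c z}
  have happrox : ∀ m, Approx G (S m).c := by
    intro m z hz
    change _ ↔ Bit (S (z + 1)).c z
    rcases le_total m (z + 1) with h | h <;> obtain ⟨k, hk⟩ := Nat.exists_eq_add_of_le h <;> rw [hk]
    · exact ((hS m k).ext.2 z hz).symm
    · exact (hS (z + 1) k).ext.2 z (hl z (S z))
  have hadmits : ∀ m, (S m).Admits G := by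
    intro m
    refine ⟨fun z hz => ?_, fun i => ?_, happrox m⟩
    · have h := (hS m (z + 1)).agree z hz
      have hlt : z < len (S (m + (z + 1))).c :=
        (show z ≤ m + z by omega).trans_lt (hl (m + z) (S (m + z)))
      exact ((happrox _ z hlt).symm.trans ((S (m + (z + 1))).adm z hlt h.1)).trans h.2
    · obtain ⟨k, hk⟩ := Nat.exists_eq_add_of_le (Nat.left_le_pair m i)
      have h := hE (Nat.pair m i) (S (Nat.pair m i))
      refine ⟨_, happrox (Nat.pair m i + 1), (hS m (k + 1)).family i _ ?_⟩
      rw [Nat.unpair_pair] at h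
      rw [← add_assoc, ← hk]
      exact h
  refine ⟨G, fun m => (hdiag m (S m)).imp (fun h => ?_) fun h => h G (hadmits (m + 1))⟩
  refine ⟨h.2 G (hadmits (m + 1)), fun j => ?_⟩
  have hfree : ∀ k z, (S (m + 1 + k)).O z → column z ≠ m := by
    intro k
    induction k with
    | zero => exact h.1
    | succ k ih =>
      intro z hz
      rcases hO (m + 1 + k) _ z hz with hz | hz
      · exact ih z hz
      · omega
  have := hX (Nat.pair m j) (S (Nat.pair m j))
  simp only [Nat.unpair_pair] at this
  obtain ⟨k, hk⟩ := Nat.exists_eq_add_of_le (Nat.left_le_pair m j)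
  refine this (fun z hz => hfree k z ?_) G (happrox (Nat.pair m j + 1))
  rw [show m + 1 + k = Nat.pair m j + 1 by omega]
  exact hz

end Construction

theorem countable_larith_symbols : Countable Larith.Symbols := by
  have h₁ : ∀ n, Countable (ArithFunc n) := fun n =>
    (show Function.Injective fun f : ArithFunc n =>
      (match f with | .zero => 0 | .one => 1 | .add => 2 | .mul => 3 : ℕ) by
      intro f g h; cases f <;> cases g <;> simp_all).countable
  have h₂ : ∀ n, Countable (ArithRel n) := fun n =>
    (show Function.Injective fun _ : ArithRel n => (0 : ℕ) by
      intro f g _; cases f; cases g; rfl).countable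
  exact inferInstanceAs (Countable ((Σ n, ArithFunc n) ⊕ Σ n, ArithRel n))

theorem countable_sum_symbols : Countable (Larith.sum Lb).Symbols := by
  have := countable_larith_symbols
  have h₁ : ∀ n, Countable (Larith.Functions n ⊕ Lb.Functions n) := fun n => by
    have : Countable (Larith.Functions n) :=
      (show Function.Injective fun f : Larith.Functions n => (Sum.inl ⟨n, f⟩ : Larith.Symbols) by
        intro f g h; simpa using h).countable
    exact inferInstanceAs (Countable (Larith.Functions n ⊕ Empty))
  have h₂ : ∀ n, Countable (Larith.Relations n ⊕ Lb.Relations n) := fun n => by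
    have : Countable (Larith.Relations n) :=
      (show Function.Injective fun f : Larith.Relations n => (Sum.inr ⟨n, f⟩ : Larith.Symbols) by
        intro f g h; simpa using h).countable
    exact inferInstanceAs (Countable (Larith.Relations n ⊕ PLift (n = 2)))
  exact inferInstanceAs (Countable ((Σ n, Larith.Functions n ⊕ Lb.Functions n) ⊕
    Σ n, Larith.Relations n ⊕ Lb.Relations n))

theorem countable_formula {L : FirstOrder.Language.{0, 0}} (hL : Countable L.Symbols) :
    Countable (L.Formula (Fin 1)) := by
  have hL' : L.card ≤ Cardinal.aleph0 := Cardinal.mk_le_aleph0_iff.mpr hL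
  have h : Cardinal.mk (Σ n, L.BoundedFormula (Fin 1) n) ≤ Cardinal.aleph0 :=
    BoundedFormula.card_le.trans (by simpa using hL')
  have := Cardinal.mk_le_aleph0_iff.mp h
  exact (show Function.Injective fun φ : L.Formula (Fin 1) =>
    (⟨0, φ⟩ : Σ n, L.BoundedFormula (Fin 1) n) by intro φ ψ h; simpa using h).countable

end ArithForcing

open ArithForcing

/-- **Marks's lemma.** There is a set `B ⊆ ℕ × ℕ` such that the set
`{n ∈ ℕ | the section Bₙ is arithmetic}` is not definable in the structure
`⟨ℕ, +, ·, 0, 1, <, B⟩`, i.e. is not arithmetic in `B`. -/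
theorem sections_being_arithmetic_not_arithmetic_in_B :
    ∃ B : Set (ℕ × ℕ),
      ¬ ∃ φ : (Larith.sum Lb).Formula (Fin 1),
        ∀ n : ℕ, IsArithmetic {k | (n, k) ∈ B} ↔
          @FirstOrder.Language.Formula.Realize (Larith.sum Lb) ℕ (bStructure B) (Fin 1)
            φ ![n] := by
  have := countable_formula countable_larith_symbols
  have := countable_formula countable_sum_symbols
  have : Nonempty (Larith.Formula (Fin 1)) := ⟨⊥⟩
  have : Nonempty ((Larith.sum Lb).Formula (Fin 1)) := ⟨⊥⟩
  obtain ⟨ψ, hψ⟩ := exists_surjective_nat (Larith.Formula (Fin 1))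
  obtain ⟨θ, hθ⟩ := exists_surjective_nat ((Larith.sum Lb).Formula (Fin 1))
  choose ι hι using fun m => exists_beta 1 fun _ => m
  obtain ⟨G, hG⟩ := exists_diagonal_set _ ι
    (fun m {_ _} hO hA => forceable_realize hO hA (θ m)) fun j y => (ψ j).Realize ![y]
  refine ⟨decode G, fun ⟨φ, hφ⟩ => ?_⟩
  obtain ⟨m, rfl⟩ := hθ φ
  have hreal : @Formula.Realize (Larith.sum Lb) ℕ (bStructure (decode G)) _ (θ m) ![m] ↔
      @BoundedFormula.Realize (Larith.sum Lb) ℕ (bStructure (decode G)) _ _ (θ m)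
        (fun _ => Nat.beta (ι m) 0) fun k : Fin 0 => Nat.beta (ι m) (k + 1) := by
    refine iff_of_eq (congr_arg₂ _ (funext fun k => ?_) (Subsingleton.elim _ _))
    rw [hι m 0 Nat.one_pos, Subsingleton.elim k 0]
    rfl
  have hm := hφ m
  rw [hreal] at hm
  rcases hG m with ⟨hQ, hX⟩ | ⟨hAr, hQ⟩
  · obtain ⟨φ, hφ⟩ := hm.mpr hQ
    obtain ⟨j, rfl⟩ := hψ φ
    obtain ⟨y, hy⟩ := hX j
    exact hy (hφ y)
  · exact hQ (hm.mp (isArithmetic_iff.mpr hAr))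
end

section
/- If T is the first-order theory asserting of a new predicate symbol Tr that it is a full satisfaction class over a model of PA (together with the elementary diagram of a model N₀ admitting a truth predicate), and if every model of T had its Tr-interpretation determined by its arithmetic reduct, then truth would be explicitly arithmetically definable, contradicting Tarski; hence T is not an implicit definition of Tr. -/
open FirstOrder FirstOrder.Language FirstOrder.Language.Structure

open Larith

/-- A Gödelized syntax scheme: first-order formulas of the language of arithmetic describing
the internal (arithmetized) syntax of arithmetic inside a model: the class of (codes of)
internal sentences, atomic sentences and their truth, and the graphs of the syntactic
operations of conjunction, negation, existential quantification and substitution of a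
numeral into a formula with one free variable. -/
structure SatScheme : Type where
  /-- `x` is (the code of) an internal sentence -/
  sent : Larith.Formula (Fin 1)
  /-- `x` is an internal atomic sentence -/
  atom : Larith.Formula (Fin 1)
  /-- the internal atomic sentence `x` is true (atomic truth is definable) -/
  atomTrue : Larith.Formula (Fin 1)
  /-- `z` is the conjunction of the internal sentences `x` and `y` -/
  conj : Larith.Formula (Fin 3)
  /-- `y` is the negation of the internal sentence `x` -/
  neg : Larith.Formula (Fin 2)
  /-- `y` is the existential quantification of the internal formula `x` (one free variable) -/
  exist : Larith.Formula (Fin 2)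
  /-- `z` is the result of substituting the numeral of `y` into the internal formula `x` -/
  subst : Larith.Formula (Fin 3)

/-- `Tr` is a full satisfaction class (truth predicate) on the model `N`, with respect to the
internal syntax given by the scheme `S`: a set of internal sentences satisfying the recursive
Tarskian truth conditions for atomic sentences, conjunction, negation, and existential
quantification (witnessed by substituted numerals). -/
def IsSatClass (S : SatScheme) (N : Type*) [Larith.Structure N] (Tr : Set N) : Prop :=
  (∀ a ∈ Tr, S.sent.Realize ![a]) ∧
  (∀ a : N, S.atom.Realize ![a] → (a ∈ Tr ↔ S.atomTrue.Realize ![a])) ∧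
  (∀ σ τ c : N, S.sent.Realize ![σ] → S.sent.Realize ![τ] → S.conj.Realize ![σ, τ, c] →
    (c ∈ Tr ↔ σ ∈ Tr ∧ τ ∈ Tr)) ∧
  (∀ σ c : N, S.sent.Realize ![σ] → S.neg.Realize ![σ, c] → (c ∈ Tr ↔ σ ∉ Tr)) ∧
  (∀ φ c : N, S.exist.Realize ![φ, c] →
    (c ∈ Tr ↔ ∃ n s : N, S.subst.Realize ![φ, n, s] ∧ s ∈ Tr))

/-- `X` is definable in `N` by a formula of the language of arithmetic with parameters. -/
def DefinableWithParams (N : Type*) [Larith.Structure N] (X : Set N) : Prop :=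
  ∃ (k : ℕ) (φ : Larith.BoundedFormula (Fin k) 1) (v : Fin k → N),
    ∀ x : N, x ∈ X ↔ φ.Realize v ![x]

namespace FirstOrder.Language

open Filter

section Ultrapower

universe u v w x

variable {L : Language.{u, v}} {ι : Type*} (U : Ultrafilter ι) {A : Type w} [L.Structure A]

/-- The subset of an ultrapower induced by a subset of the base. -/
def ultrapowerSet (P : Set A) : Set ((U : Filter ι).Product fun _ => A) :=
  {z | ∃ g : ι → A, (g : (U : Filter ι).Product fun _ => A) = z ∧ ∀ᶠ i in (U : Filter ι), g i ∈ P}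

variable {U}

theorem mk_mem_ultrapowerSet {P : Set A} {g : ι → A} :
    (g : (U : Filter ι).Product fun _ => A) ∈ ultrapowerSet U P ↔
      ∀ᶠ i in (U : Filter ι), g i ∈ P := by
  refine ⟨?_, fun h => ⟨g, rfl, h⟩⟩
  rintro ⟨g', hg', h⟩
  have hgg : ∀ᶠ i in (U : Filter ι), g' i = g i := Quotient.exact hg'
  filter_upwards [h, hgg] with i hi hi'
  rwa [← hi']

variable [Nonempty A] {B : Type x} [L.Structure B]

/-- A family of maps along which each formula is eventually preserved induces an elementary
embedding into the ultrapower. -/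
def ElementaryEmbedding.toUltrapower (U : Ultrafilter ι) (e : ι → B → A)
    (he : ∀ (n : ℕ) (φ : L.Formula (Fin n)) (y : Fin n → B), φ.Realize y →
      ∀ᶠ i in (U : Filter ι), φ.Realize (e i ∘ y)) :
    B ↪ₑ[L] (U : Filter ι).Product fun _ => A where
  toFun b := ((fun i => e i b : ι → A) : (U : Filter ι).Product fun _ => A)
  map_formula' n φ y := by
    refine (Ultraproduct.realize_formula_cast φ fun j i => e i (y j)).trans ⟨fun h => ?_, he n φ y⟩
    by_contra hn
    have h' := he n φ.not y (Formula.realize_not.2 hn)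
    obtain ⟨i, hi, hi'⟩ := (h.and h').exists
    exact Formula.realize_not.1 hi' hi

/-- The diagonal elementary embedding of a structure into its ultrapower. -/
def ElementaryEmbedding.diagonal (U : Ultrafilter ι) :
    A ↪ₑ[L] (U : Filter ι).Product fun _ => A :=
  toUltrapower U (fun _ => id) fun _ _ _ h => Eventually.of_forall fun _ => h

/-- A formula true in `B` can be transferred to `A` while respecting a partial elementary map. -/
theorem exists_extend_realize {X : Type*} {α : X → A} {β : X → B} (hβ : Function.Injective β)
    (hαβ : ∀ φ : L.Formula X, φ.Realize β → φ.Realize α) (ψ : L.Formula B) (hψ : ψ.Realize id) :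
    ∃ w : B → A, ψ.Realize (Function.extend β α w) := by
  classical
  let f : ψ.freeVarFinset → X ⊕ ψ.freeVarFinset := fun b =>
    if h : ∃ x, β x = b then .inl h.choose else .inr b
  let θ : L.Formula (X ⊕ ψ.freeVarFinset) := BoundedFormula.restrictFreeVar ψ f
  have hθB : (θ.iExs ψ.freeVarFinset).Realize β := by
    rw [Formula.realize_iExs]
    refine ⟨fun b => b, (BoundedFormula.realize_restrictFreeVar (φ := ψ) id fun b => ?_).2 hψ⟩
    by_cases h : ∃ x, β x = b
    · simp only [f, dif_pos h, Sum.elim_inl, id]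
      exact h.choose_spec
    · simp only [f, dif_neg h, Sum.elim_inr, id]
  obtain ⟨w, hw⟩ := Formula.realize_iExs.1 (hαβ _ hθB)
  refine ⟨fun b => if h : b ∈ ψ.freeVarFinset then w ⟨b, h⟩ else Classical.arbitrary A,
    (BoundedFormula.realize_restrictFreeVar (φ := ψ) _ fun b => ?_).1 hw⟩
  by_cases h : ∃ x, β x = b
  · simp only [f, dif_pos h, Sum.elim_inl]
    conv_rhs => rw [← h.choose_spec, hβ.extend_apply]
  · simp only [f, dif_neg h, Sum.elim_inr, Function.extend_apply' _ _ _ h, dif_pos b.2]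

/-- If `β x ↦ α x` is a partial elementary map from `B` to `A`, then it extends to an elementary
embedding of `B` into an ultrapower of `A`. -/
theorem exists_elementaryEmbedding_ultrapower {X : Type*} {α : X → A} {β : X → B}
    (hβ : Function.Injective β) (hαβ : ∀ φ : L.Formula X, φ.Realize β → φ.Realize α) :
    ∃ (U : Ultrafilter (Finset (L.Formula B)))
      (k : B ↪ₑ[L] (U : Filter (Finset (L.Formula B))).Product fun _ => A),
      ∀ x, k (β x) = ElementaryEmbedding.diagonal (L := L) U (α x) := by
  classical
  have key : ∀ F : Finset (L.Formula B), ∃ w : B → A, ∀ φ ∈ F, φ.Realize id →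
      φ.Realize (Function.extend β α w) := by
    intro F
    let G := {φ : F // φ.1.Realize (id : B → B)}
    obtain ⟨w, hw⟩ := exists_extend_realize hβ hαβ (Formula.iInf fun φ : G => φ.1.1)
      (Formula.realize_iInf.2 fun φ => φ.2)
    exact ⟨w, fun φ hφ h => Formula.realize_iInf.1 hw ⟨⟨φ, hφ⟩, h⟩⟩
  choose w hw using key
  let U : Ultrafilter (Finset (L.Formula B)) := Ultrafilter.of atTop
  refine ⟨U, .toUltrapower U (fun F => Function.extend β α (w F)) fun n φ y h => ?_, fun x => ?_⟩
  · have hle : (U : Filter (Finset (L.Formula B))) ≤ atTop := Ultrafilter.of_le atTop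
    filter_upwards [hle (eventually_ge_atTop {φ.relabel y})] with F hF
    have := hw F (φ.relabel y) (hF (Finset.mem_singleton_self _))
      (by rw [Formula.realize_relabel]; exact h)
    rwa [Formula.realize_relabel] at this
  · exact congrArg (fun g : Finset (L.Formula B) → A =>
      (g : (U : Filter (Finset (L.Formula B))).Product fun _ => A))
      (funext fun F => hβ.extend_apply α (w F) x)

end Ultrapower

section Chain

universe u v w

variable {L : Language.{u, v}} {G : ℕ → Type w} [∀ n, L.Structure (G n)]

/-- **Tarski's elementary chain theorem**: an elementary chain has a union into which every member
embeds elementarily. -/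
theorem exists_elementary_chain_union (f : ∀ n, G n ↪ₑ[L] G (n + 1)) :
    ∃ (M : Type w) (_ : L.Structure M) (e : ∀ n, G n ↪ₑ[L] M),
      (∀ n x, e (n + 1) (f n x) = e n x) ∧ ∀ z, ∃ n x, e n x = z := by
  let f' : ∀ n, G n ↪[L] G (n + 1) := fun n => (f n).toEmbedding
  let F : ∀ i j, i ≤ j → G i ↪[L] G j := DirectedSystem.natLERec f'
  have hF_succ : ∀ i j (h : i ≤ j) x, F i (j + 1) (h.trans j.le_succ) x = f j (F i j h x) := by
    intro i j h x
    simp only [F, DirectedSystem.coe_natLERec]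
    rw [Nat.leRecOn_succ h]
    rfl
  have hF : ∀ i j (h : i ≤ j) {m k : ℕ} (φ : L.BoundedFormula (Fin m) k) v xs,
      φ.Realize (F i j h ∘ v) (F i j h ∘ xs) ↔ φ.Realize v xs := by
    intro i j h m k φ v xs
    induction j, h using Nat.le_induction with
    | base =>
      have : (F i i le_rfl : G i → G i) = id := by
        funext x
        simp [F, Nat.leRecOn_self]
      simp [this]
    | succ j h ih =>
      have : (F i (j + 1) (h.trans j.le_succ) : G i → G (j + 1)) = f j ∘ F i j h :=
        funext (hF_succ i j h)
      rw [this, Function.comp_assoc, Function.comp_assoc, (f j).map_boundedFormula, ih]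
  let M := DirectLimit G F
  let o : ∀ n, G n ↪[L] M := DirectLimit.of L ℕ G F
  have ho : ∀ i j (h : i ≤ j) x, o j (F i j h x) = o i x := fun i j h x => DirectLimit.of_f
  have hex : ∀ z : M, ∃ n x, o n x = z := DirectLimit.exists_of
  have hre : ∀ {m k : ℕ} (φ : L.BoundedFormula (Fin m) k) (n : ℕ) (v : Fin m → G n) xs,
      φ.Realize (o n ∘ v) (o n ∘ xs) ↔ φ.Realize v xs := by
    intro m k φ
    induction φ with
    | falsum => intro n v xs; rfl
    | equal t₁ t₂ =>
      intro n v xs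
      simp only [BoundedFormula.Realize, ← Sum.comp_elim, HomClass.realize_term,
        (o n).injective.eq_iff]
    | rel R ts =>
      intro n v xs
      simp only [BoundedFormula.Realize, ← Sum.comp_elim, HomClass.realize_term]
      exact (o n).map_rel R _
    | imp φ ψ ih₁ ih₂ =>
      intro n v xs
      simp only [BoundedFormula.Realize, ih₁, ih₂]
    | all φ ih =>
      intro n v xs
      simp only [BoundedFormula.Realize]
      refine ⟨fun h x => ?_, fun h z => ?_⟩
      · have := h (o n x)
        rwa [← Fin.comp_snoc, ih] at this
      · obtain ⟨l, y, rfl⟩ := hex z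
        have hn := le_max_left n l
        have hl := le_max_right n l
        have h1 := (hF n _ hn φ.all v xs).2 h (F l _ hl y)
        rw [← ih, Fin.comp_snoc, ← Function.comp_assoc, ← Function.comp_assoc] at h1
        have hc : (o (max n l) ∘ F n _ hn : G n → M) = o n := funext (ho n _ hn)
        rwa [hc, ho l _ hl] at h1
  refine ⟨M, inferInstance, fun n => ⟨o n, fun m φ x => ?_⟩, fun n x => ?_, hex⟩
  · rw [Formula.Realize, Formula.Realize, ← hre φ n x]
    exact iff_of_eq (congrArg _ (Subsingleton.elim _ _))
  · have h1 := hF_succ n n le_rfl x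
    have h2 : F n n le_rfl x = x := by simp [F, Nat.leRecOn_self]
    rw [h2] at h1
    exact (congrArg (o (n + 1)) h1).symm.trans (ho n (n + 1) n.le_succ x)

end Chain

end FirstOrder.Language

open Filter

/-- A set `P` that is not definable contains a point agreeing with some point outside `P` on any
prescribed finite set of formulas. -/
theorem exists_agree_of_not_definable {N : Type*} [Larith.Structure N] {P : Set N}
    (h : ¬ DefinableWithParams N P) (F : Finset (Larith.Formula (Fin 1))) :
    ∃ a ∈ P, ∃ b ∉ P, ∀ φ ∈ F, φ.Realize ![a] ↔ φ.Realize ![b] := by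
  classical
  by_contra! hc
  apply h
  let tp : N → Set F := fun a => {φ | φ.1.Realize ![a]}
  let lit : F → Set F → Larith.Formula (Fin 1) := fun φ s => if φ ∈ s then φ.1 else φ.1.not
  let θ : Larith.Formula (Fin 1) :=
    Formula.iSup fun s : {s : Set F // ∃ a ∈ P, tp a = s} => Formula.iInf fun φ : F => lit φ s.1
  have hlit : ∀ φ s x, (lit φ s).Realize ![x] ↔ (φ ∈ tp x ↔ φ ∈ s) := by
    intro φ s x
    by_cases hs : φ ∈ s <;> simp [lit, hs, tp, Formula.realize_not]
  have hθ : ∀ x, θ.Realize ![x] ↔ x ∈ P := by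
    intro x
    rw [Formula.realize_iSup]
    simp only [Formula.realize_iInf, hlit, ← Set.ext_iff]
    constructor
    · rintro ⟨⟨s, a, ha, rfl⟩, hx⟩
      by_contra hxP
      obtain ⟨φ, hφ, hne⟩ := hc a ha x hxP
      have := Set.ext_iff.1 hx ⟨φ, hφ⟩
      simp only [tp, Set.mem_ofPred_eq] at this
      rcases hne with hne | hne <;> tauto
    · exact fun hx => ⟨⟨tp x, x, hx, rfl⟩, rfl⟩
  refine ⟨0, BoundedFormula.relabel (fun i : Fin 1 => (Sum.inr i : Fin 0 ⊕ Fin 1)) θ, ![],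
    fun x => ?_⟩
  rw [← hθ, BoundedFormula.realize_relabel, Formula.Realize]
  refine iff_of_eq ?_
  congr 1
  exact Subsingleton.elim _ _

namespace IsSatClass

variable {S : SatScheme}

theorem ultrapower {ι : Type*} (U : Ultrafilter ι) {A : Type*} [Larith.Structure A] [Nonempty A]
    {P : Set A} (hP : IsSatClass S A P) :
    IsSatClass S ((U : Filter ι).Product fun _ => A) (ultrapowerSet U P) := by
  let mk : (ι → A) → (U : Filter ι).Product fun _ => A := fun g => g
  have surj : ∀ z, ∃ g, mk g = z := Quotient.exists_rep
  have mem : ∀ g, mk g ∈ ultrapowerSet U P ↔ ∀ᶠ i in (U : Filter ι), g i ∈ P :=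
    fun _ => mk_mem_ultrapowerSet
  have los : ∀ {n : ℕ} (φ : Larith.Formula (Fin n)) (v : Fin n → ι → A),
      φ.Realize (mk ∘ v) ↔ ∀ᶠ i in (U : Filter ι), φ.Realize fun j => v j i :=
    fun φ v => Ultraproduct.realize_formula_cast φ v
  have los₁ : ∀ (φ : Larith.Formula (Fin 1)) (a : ι → A),
      φ.Realize ![mk a] ↔ ∀ᶠ i in (U : Filter ι), φ.Realize ![a i] := by
    intro φ a
    refine (iff_of_eq (congrArg φ.Realize ?_)).trans ((los φ ![a]).trans
      (eventually_congr (.of_forall fun i => iff_of_eq (congrArg φ.Realize ?_)))) <;>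
    (funext j; fin_cases j; rfl)
  have los₂ : ∀ (φ : Larith.Formula (Fin 2)) (a b : ι → A),
      φ.Realize ![mk a, mk b] ↔ ∀ᶠ i in (U : Filter ι), φ.Realize ![a i, b i] := by
    intro φ a b
    refine (iff_of_eq (congrArg φ.Realize ?_)).trans ((los φ ![a, b]).trans
      (eventually_congr (.of_forall fun i => iff_of_eq (congrArg φ.Realize ?_)))) <;>
    (funext j; fin_cases j <;> rfl)
  have los₃ : ∀ (φ : Larith.Formula (Fin 3)) (a b c : ι → A),
      φ.Realize ![mk a, mk b, mk c] ↔ ∀ᶠ i in (U : Filter ι), φ.Realize ![a i, b i, c i] := by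
    intro φ a b c
    refine (iff_of_eq (congrArg φ.Realize ?_)).trans ((los φ ![a, b, c]).trans
      (eventually_congr (.of_forall fun i => iff_of_eq (congrArg φ.Realize ?_)))) <;>
    (funext j; fin_cases j <;> rfl)
  obtain ⟨hsent, hatom, hconj, hneg, hexist⟩ := hP
  refine ⟨fun a ha => ?_, fun a ha => ?_, fun a b c ha hb hc => ?_, fun a c ha hc => ?_,
    fun a c hc => ?_⟩
  · obtain ⟨a, rfl⟩ := surj a
    exact (los₁ _ _).2 (((mem a).1 ha).mono fun i hi => hsent _ hi)
  · obtain ⟨a, rfl⟩ := surj a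
    rw [los₁] at ha ⊢
    rw [mem]
    exact eventually_congr (ha.mono fun i hi => hatom _ hi)
  · obtain ⟨a, rfl⟩ := surj a
    obtain ⟨b, rfl⟩ := surj b
    obtain ⟨c, rfl⟩ := surj c
    rw [los₁] at ha hb
    rw [los₃] at hc
    rw [mem, mem, mem, ← eventually_and]
    apply eventually_congr
    filter_upwards [ha, hb, hc] with i hai hbi hci using hconj _ _ _ hai hbi hci
  · obtain ⟨a, rfl⟩ := surj a
    obtain ⟨c, rfl⟩ := surj c
    rw [los₁] at ha
    rw [los₂] at hc
    rw [mem, mem, ← Ultrafilter.eventually_not]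
    apply eventually_congr
    filter_upwards [ha, hc] with i hai hci using hneg _ _ hai hci
  · obtain ⟨a, rfl⟩ := surj a
    obtain ⟨c, rfl⟩ := surj c
    rw [los₂] at hc
    rw [mem]
    constructor
    · intro h
      have hw : ∀ᶠ i in (U : Filter ι), ∃ p : A × A, S.subst.Realize ![a i, p.1, p.2] ∧ p.2 ∈ P := by
        filter_upwards [h, hc] with i hi hci
        obtain ⟨n, s, hns⟩ := (hexist _ _ hci).1 hi
        exact ⟨(n, s), hns⟩
      obtain ⟨p, hp⟩ := hw.choice
      exact ⟨mk fun i => (p i).1, mk fun i => (p i).2,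
        (los₃ _ _ _ _).2 (hp.mono fun _ h => h.1), (mem _).2 (hp.mono fun _ h => h.2)⟩
    · rintro ⟨n, s, hns, hs⟩
      obtain ⟨n, rfl⟩ := surj n
      obtain ⟨s, rfl⟩ := surj s
      rw [los₃] at hns
      rw [mem] at hs
      filter_upwards [hns, hs, hc] with i h1 h2 hci using (hexist _ _ hci).2 ⟨n i, s i, h1, h2⟩

/-- A directed union of satisfaction classes along elementary embeddings is a satisfaction
class. -/
theorem union {κ : Type*} {G : κ → Type*} [∀ i, Larith.Structure (G i)] {M : Type*}
    [Larith.Structure M] (e : ∀ i, G i ↪ₑ[Larith] M) {P : ∀ i, Set (G i)} {R : Set M}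
    (hR : ∀ i x, e i x ∈ R ↔ x ∈ P i) (hP : ∀ i, IsSatClass S (G i) (P i))
    (hcover : ∀ v : Fin 4 → M, ∃ i, ∀ j, v j ∈ Set.range (e i)) : IsSatClass S M R := by
  have e₁ : ∀ i (φ : Larith.Formula (Fin 1)) a, φ.Realize ![e i a] ↔ φ.Realize ![a] := by
    intro i φ a
    rw [← (e i).map_formula φ ![a] ]
    exact iff_of_eq (congrArg _ (funext fun j => by fin_cases j; rfl))
  have e₂ : ∀ i (φ : Larith.Formula (Fin 2)) a b,
      φ.Realize ![e i a, e i b] ↔ φ.Realize ![a, b] := by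
    intro i φ a b
    rw [← (e i).map_formula φ ![a, b] ]
    exact iff_of_eq (congrArg _ (funext fun j => by fin_cases j <;> rfl))
  have e₃ : ∀ i (φ : Larith.Formula (Fin 3)) a b c,
      φ.Realize ![e i a, e i b, e i c] ↔ φ.Realize ![a, b, c] := by
    intro i φ a b c
    rw [← (e i).map_formula φ ![a, b, c] ]
    exact iff_of_eq (congrArg _ (funext fun j => by fin_cases j <;> rfl))
  have cover : ∀ a b c d : M, ∃ i a' b' c' d',
      e i a' = a ∧ e i b' = b ∧ e i c' = c ∧ e i d' = d := by
    intro a b c d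
    obtain ⟨i, hi⟩ := hcover ![a, b, c, d]
    obtain ⟨a', ha⟩ := hi 0
    obtain ⟨b', hb⟩ := hi 1
    obtain ⟨c', hc⟩ := hi 2
    obtain ⟨d', hd⟩ := hi 3
    exact ⟨i, a', b', c', d', ha, hb, hc, hd⟩
  refine ⟨fun a ha => ?_, fun a ha => ?_, fun a b c ha hb hc => ?_, fun a c ha hc => ?_,
    fun a c hc => ⟨fun h => ?_, ?_⟩⟩
  · obtain ⟨i, a, -, -, -, rfl, -⟩ := cover a a a a
    exact (e₁ _ _ _).2 ((hP i).1 _ ((hR _ _).1 ha))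
  · obtain ⟨i, a, -, -, -, rfl, -⟩ := cover a a a a
    rw [e₁] at ha ⊢
    rw [hR]
    exact (hP i).2.1 _ ha
  · obtain ⟨i, a, b, c, -, rfl, rfl, rfl, -⟩ := cover a b c c
    rw [e₁] at ha hb
    rw [e₃] at hc
    rw [hR, hR, hR]
    exact (hP i).2.2.1 _ _ _ ha hb hc
  · obtain ⟨i, a, c, -, -, rfl, rfl, -⟩ := cover a c c c
    rw [e₁] at ha
    rw [e₂] at hc
    rw [hR, hR]
    exact (hP i).2.2.2.1 _ _ ha hc
  · obtain ⟨i, a, c, -, -, rfl, rfl, -⟩ := cover a c c c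
    rw [e₂] at hc
    obtain ⟨n, s, hns, hs⟩ := ((hP i).2.2.2.2 _ _ hc).1 ((hR _ _).1 h)
    exact ⟨e i n, e i s, (e₃ _ _ _ _ _).2 hns, (hR _ _).2 hs⟩
  · rintro ⟨n, s, hns, hs⟩
    obtain ⟨i, a, c, n, s, rfl, rfl, rfl, rfl⟩ := cover a c n s
    rw [e₂] at hc
    rw [e₃] at hns
    rw [hR] at hs ⊢
    exact ((hP i).2.2.2.2 _ _ hc).2 ⟨n, s, hns, hs⟩

end IsSatClass

/-- Two models carrying satisfaction classes, the first elementarily embedded (as an arithmetic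
structure) into the second. -/
structure SatPair (S : SatScheme) where
  /-- the first model -/
  fst : Type
  /-- the second model -/
  snd : Type
  [fstStr : Larith.Structure fst]
  [sndStr : Larith.Structure snd]
  /-- the satisfaction class of the first model -/
  fstTr : Set fst
  /-- the satisfaction class of the second model -/
  sndTr : Set snd
  isSat_fst : IsSatClass S fst fstTr
  isSat_snd : IsSatClass S snd sndTr
  nonempty_fst : Nonempty fst
  /-- the embedding of arithmetic reducts -/
  emb : fst ↪ₑ[Larith] snd

namespace SatPair

variable {S : SatScheme}

attribute [instance] fstStr sndStr

/-- Robinson's zigzag step: the second model of a pair embeds into a third one whose satisfaction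
class extends that of the first. -/
theorem exists_next (p : SatPair S) :
    ∃ (C : Type) (_ : Larith.Structure C) (R : Set C) (k : p.snd ↪ₑ[Larith] C),
      IsSatClass S C R ∧ ∀ x, k (p.emb x) ∈ R ↔ x ∈ p.fstTr := by
  have := p.nonempty_fst
  obtain ⟨U, k, hk⟩ := exists_elementaryEmbedding_ultrapower (L := Larith) (α := id)
    p.emb.injective fun φ h => (p.emb.map_formula φ id).1 h
  refine ⟨_, inferInstance, ultrapowerSet U p.fstTr, k, p.isSat_fst.ultrapower U, fun x => ?_⟩
  rw [hk]
  exact mk_mem_ultrapowerSet.trans eventually_const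

/-- The pair formed by the second model of `p` and the model given by the zigzag step. -/
noncomputable def next (p : SatPair S) : SatPair S :=
  letI := p.exists_next.choose_spec.choose
  { fst := p.snd
    snd := p.exists_next.choose
    fstTr := p.sndTr
    sndTr := p.exists_next.choose_spec.choose_spec.choose
    isSat_fst := p.isSat_snd
    isSat_snd := p.exists_next.choose_spec.choose_spec.choose_spec.choose_spec.1
    nonempty_fst := p.nonempty_fst.map p.emb
    emb := p.exists_next.choose_spec.choose_spec.choose_spec.choose }

theorem next_emb_mem_iff (p : SatPair S) (x : p.fst) :
    p.next.emb (p.emb x : p.snd) ∈ p.next.sndTr ↔ x ∈ p.fstTr :=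
  p.exists_next.choose_spec.choose_spec.choose_spec.choose_spec.2 x

/-- The iterated zigzag. -/
noncomputable def iter (p : SatPair S) : ℕ → SatPair S
  | 0 => p
  | n + 1 => (p.iter n).next

/-- Any pair of models embeds into a common model carrying satisfaction classes that extend those
of the two members (Robinson's joint consistency). -/
theorem exists_joint (p : SatPair S) :
    ∃ (M : Type) (_ : Larith.Structure M) (e : p.snd ↪ₑ[Larith] M) (T₁ T₂ : Set M),
      IsSatClass S M T₁ ∧ IsSatClass S M T₂ ∧
      (∀ x, e (p.emb x) ∈ T₁ ↔ x ∈ p.fstTr) ∧ ∀ x, e x ∈ T₂ ↔ x ∈ p.sndTr := by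
  let G : ℕ → Type := fun n => (p.iter n).fst
  let f : ∀ n, G n ↪ₑ[Larith] G (n + 1) := fun n => (p.iter n).emb
  let P : ∀ n, Set (G n) := fun n => (p.iter n).fstTr
  have hP : ∀ n x, f (n + 1) (f n x) ∈ P (n + 2) ↔ x ∈ P n := fun n x =>
    (p.iter n).next_emb_mem_iff x
  obtain ⟨M, _, e, he, hM⟩ := exists_elementary_chain_union f
  have up : ∀ n m x, n ≤ m → ∃ y, e m y = e n x := by
    intro n m x h
    induction m, h using Nat.le_induction with
    | base => exact ⟨x, rfl⟩
    | succ m h ih =>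
      obtain ⟨y, hy⟩ := ih
      exact ⟨f m y, (he m y).trans hy⟩
  have upP : ∀ n m k x, m = n + 2 * k → ∃ y, e m y = e n x ∧ (y ∈ P m ↔ x ∈ P n) := by
    rintro n _ k x rfl
    induction k with
    | zero => exact ⟨x, rfl, Iff.rfl⟩
    | succ k ih =>
      obtain ⟨y, hy, hy'⟩ := ih
      exact ⟨f _ (f _ y), (he _ _).trans ((he _ _).trans hy), (hP _ _).trans hy'⟩
  let R : ℕ → Set M := fun r => {z | ∃ k x, e (r + 2 * k) x = z ∧ x ∈ P (r + 2 * k)}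
  have hR : ∀ r k x, e (r + 2 * k) x ∈ R r ↔ x ∈ P (r + 2 * k) := by
    intro r k x
    refine ⟨?_, fun h => ⟨k, x, rfl, h⟩⟩
    rintro ⟨l, y, hyx, hy⟩
    obtain ⟨x', hx', hxP⟩ := upP (r + 2 * k) (r + 2 * (k + l)) l x (by ring)
    obtain ⟨y', hy', hyP⟩ := upP (r + 2 * l) (r + 2 * (k + l)) k y (by ring)
    have hxy : x' = y' := (e _).injective (hx'.trans (hyx.symm.trans hy'.symm))
    rwa [← hxP, hxy, hyP]
  have hsat : ∀ r, IsSatClass S M (R r) := by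
    intro r
    refine IsSatClass.union (fun k => e (r + 2 * k)) (hR r) (fun k => (p.iter _).isSat_fst) ?_
    intro v
    choose n x hx using fun j => hM (v j)
    refine ⟨Finset.univ.sup n, fun j => ?_⟩
    have hj : n j ≤ Finset.univ.sup n := Finset.le_sup (Finset.mem_univ j)
    obtain ⟨y, hy⟩ := up (n j) (r + 2 * Finset.univ.sup n) (x j) (by omega)
    exact ⟨y, hy.trans (hx j)⟩
  exact ⟨M, inferInstance, e 1, R 0, R 1, hsat 0, hsat 1,
    fun x => (iff_of_eq (congrArg (· ∈ R 0) (he 0 x))).trans (hR 0 0 x), hR 1 0⟩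

end SatPair

/-- A model whose satisfaction class is undefinable extends elementarily to one in which the
satisfaction class separates two points satisfying the same arithmetic formulas. -/
theorem IsSatClass.exists_separated {S : SatScheme} {N : Type} [Larith.Structure N] [Nonempty N]
    {P : Set N} (hP : IsSatClass S N P) (h : ¬ DefinableWithParams N P) :
    ∃ (A : Type) (_ : Larith.Structure A) (_ : Nonempty A) (_ : N ↪ₑ[Larith] A) (Q : Set A),
      IsSatClass S A Q ∧ ∃ a ∈ Q, ∃ b ∉ Q, ∀ φ : Larith.Formula (Fin 1),
        φ.Realize (fun _ => a) → φ.Realize (fun _ => b) := by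
  choose a ha b hb hab using exists_agree_of_not_definable h
  let U : Ultrafilter (Finset (Larith.Formula (Fin 1))) := Ultrafilter.of atTop
  refine ⟨(U : Filter (Finset (Larith.Formula (Fin 1)))).Product fun _ => N, inferInstance,
    Ultraproduct.Product.instNonempty, ElementaryEmbedding.diagonal U, ultrapowerSet U P,
    hP.ultrapower U, a, mk_mem_ultrapowerSet.2 (.of_forall ha), b, fun hbU => ?_, fun φ hφ => ?_⟩
  · obtain ⟨F, hF⟩ := (mk_mem_ultrapowerSet.1 hbU).exists
    exact hb F hF
  · have h' := (Ultraproduct.realize_formula_cast φ fun _ => a).1 hφ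
    have hle : (U : Filter (Finset (Larith.Formula (Fin 1)))) ≤ atTop := Ultrafilter.of_le atTop
    refine (Ultraproduct.realize_formula_cast φ fun _ => b).2 ?_
    filter_upwards [h', hle (eventually_ge_atTop {φ})] with F hF hmem
    have hvec : ∀ x : N, (fun _ : Fin 1 => x) = ![x] := fun x =>
      funext fun j => by fin_cases j; rfl
    rw [hvec] at hF ⊢
    exact (hab F φ (hmem (Finset.mem_singleton_self φ))).1 hF

/-- The theory `T` consisting of the elementary diagram of a model `N₀ ⊨ PA` together with the
assertion "`Tr` is a full satisfaction class" is *not* an implicit definition of `Tr`: it is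
false that the interpretation of `Tr` in every model of `T` is determined by the arithmetic
reduct.  (Models of `T` are exactly the elementary extensions `M` of `N₀` equipped with a full
satisfaction class; were `Tr` implicitly defined, Beth's theorem would make truth explicitly
arithmetically definable, contradicting Tarski's theorem — recorded here as the hypothesis
that the given satisfaction class `Tr₀` is not definable with parameters.) -/
theorem satisfaction_class_theory_is_not_an_implicit_definition
    (S : SatScheme) (N₀ : Type) [Larith.Structure N₀] (hPA : IsPAModel N₀)
    (Tr₀ : Set N₀) (hsat : IsSatClass S N₀ Tr₀) (hundef : ¬ DefinableWithParams N₀ Tr₀) :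
    ¬ (∀ (M : Type) (inst : Larith.Structure M),
        Nonempty (@FirstOrder.Language.ElementaryEmbedding Larith N₀ M _ inst) →
        ∀ T₁ T₂ : Set M, @IsSatClass S M inst T₁ → @IsSatClass S M inst T₂ → T₁ = T₂) := by
  intro himp
  have : Nonempty N₀ := ⟨zeroF⟩
  obtain ⟨A, _, _, i, P, hP, a, ha, b, hb, hab⟩ := hsat.exists_separated hundef
  obtain ⟨V, k, hk⟩ := exists_elementaryEmbedding_ultrapower (L := Larith)
    (α := fun _ : Fin 1 => b) (β := fun _ : Fin 1 => a) (Function.injective_of_subsingleton _) hab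
  let p : SatPair S :=
    { fst := A
      snd := (V : Filter (Finset (Larith.Formula A))).Product fun _ => A
      fstTr := P
      sndTr := ultrapowerSet V P
      isSat_fst := hP
      isSat_snd := hP.ultrapower V
      nonempty_fst := inferInstance
      emb := k }
  obtain ⟨M, _, e, T₁, T₂, h₁, h₂, he₁, he₂⟩ := p.exists_joint
  have hT := himp M inferInstance ⟨(e.comp p.emb).comp i⟩ T₁ T₂ h₁ h₂
  have haT : p.emb a ∈ p.sndTr := (he₂ _).1 (hT ▸ (he₁ a).2 ha)
  have hk0 : p.emb a = ElementaryEmbedding.diagonal (L := Larith) V b := hk 0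
  rw [hk0] at haT
  exact hb (eventually_const.1 (mk_mem_ultrapowerSet.1 haT))
end
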